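/- arXiv:1311.4477 — 2 statements merged into one kernel-verified Lean document; each statement's English description precedes it below -/
import Mathlib

section
/- Let p ≥ 3, let λ ∈ ℂ_p be not a root of unity with 1/p < |1-λ| < 1, and let P_λ(x) = λx + x². Set r(P_λ) = |1-λ|^{-1/p} · r̃(λ). Then the conjugacy H_{P_λ} converges on the open disk D_{r(P_λ)}(0), diverges at every point of the sphere S_{r(P_λ)}(0), maps D_{r(P_λ)}(0) bijectively onto itself, and conjugates P_λ to x ↦ λx there; the linearization disk of P_λ is exactly Δ_{P_λ} = D_{r(P_λ)}(0). -/
open scoped BigOperators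

noncomputable section

/-- `R(s) = p^{-1/(p^{s-1}(p-1))}` for `s ≥ 1`, and `R(0) = 0`. -/
def Rr (p : ℕ) (s : ℕ) : ℝ :=
  if s = 0 then 0 else (p : ℝ) ^ (-(1 : ℝ) / ((p : ℝ) ^ (s - 1) * ((p : ℝ) - 1)))

/-- The group `Γ_r` of `p`-power roots of unity. -/
def GammaR (p : ℕ) (K : Type*) [Monoid K] : Set K := {z | ∃ k : ℕ, z ^ p ^ k = 1}

/-- The quantity `r̃(λ)`. -/
def rTilde {K : Type*} [NontriviallyNormedField K] (p : ℕ) (lam γ₀ : K) (m s t : ℕ) : ℝ :=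
  Rr p (s + 1) ^ ((1 : ℝ) / m) *
    (p : ℝ) ^ (-(((s : ℝ) - (t : ℝ)) / ((m : ℝ) * (p : ℝ) ^ s))) *
    ‖1 - lam ^ m‖ ^ ((s : ℝ) * ((p : ℝ) - 1) / ((m : ℝ) * (p : ℝ))) *
    ‖γ₀ - lam ^ m‖ ^ ((1 : ℝ) / ((m : ℝ) * (p : ℝ) ^ ((s : ℝ) - (t : ℝ))))

/-- Coefficient of `x^k` in the formal composition `H ∘ F`, where `H, F` are given by their
coefficient sequences `b, c` and `F` has zero constant term. -/
def compCoeff {K : Type*} [Field K] (b c : ℕ → K) (k : ℕ) : K :=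
  ∑ l ∈ Finset.range (k + 1), b l * PowerSeries.coeff k ((PowerSeries.mk c) ^ l)

/-- `b` is (the coefficient sequence of) the normalized formal linearizing conjugacy `H_f` for the
power series `f` with coefficient sequence `c`: `H(0)=0`, `H'(0)=1` and `H ∘ f = λ·H` as formal
power series. -/
def IsConjugacy {K : Type*} [Field K] (lam : K) (c b : ℕ → K) : Prop :=
  b 0 = 0 ∧ b 1 = 1 ∧ ∀ k, compCoeff b c k = lam * b k

/-- Evaluation of the power series with coefficients `b` at `x`. -/
def pEval {K : Type*} [NontriviallyNormedField K] (b : ℕ → K) (x : K) : K :=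
  ∑' k, b k * x ^ k

/-- `f` is analytically linearizable on `U` (a disk about `0`): `f` maps `U` to itself and some
convergent power series `h` with `h(0)=0`, `h'(0)=1` maps `U` bijectively onto itself and
conjugates `f` to `x ↦ λx` on `U`. -/
def LinearizableOn {K : Type*} [NontriviallyNormedField K] (f : K → K) (lam : K)
    (U : Set K) : Prop :=
  Set.MapsTo f U U ∧
    ∃ b : ℕ → K, b 0 = 0 ∧ b 1 = 1 ∧
      (∀ x ∈ U, Summable fun k => b k * x ^ k) ∧
      Set.BijOn (pEval b) U U ∧
      ∀ x ∈ U, pEval b (f x) = lam * pEval b x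

/-- A disk about `0`: an open or closed ball centered at the origin. -/
def IsZeroDisk {K : Type*} [NontriviallyNormedField K] (U : Set K) : Prop :=
  ∃ ρ : ℝ, U = Metric.ball (0 : K) ρ ∨ U = Metric.closedBall (0 : K) ρ

/-- `x` is a periodic point of `f` of minimal period `q`. -/
def IsMinPeriodicPt {K : Type*} (f : K → K) (q : ℕ) (x : K) : Prop :=
  f^[q] x = x ∧ ∀ j, 1 ≤ j → j < q → f^[j] x ≠ x

/-- The valuation `ν(x) = -log_p |x|`. -/
def nuP {K : Type*} [NontriviallyNormedField K] (p : ℕ) (z : K) : ℝ :=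
  -Real.logb p ‖z‖

/-- `κ_n = -(ν(1-λ^{p^n}) - ν(1-λ^{p^{n-1}}))/p^n`. -/
def kappaN {K : Type*} [NontriviallyNormedField K] (p : ℕ) (lam : K) (n : ℕ) : ℝ :=
  -(nuP p (1 - lam ^ p ^ n) - nuP p (1 - lam ^ p ^ (n - 1))) / (p : ℝ) ^ n

open Classical in
/-- The multiplicity of `x` as a zero of the analytic function `g`. -/
def analyticMult {K : Type*} [NontriviallyNormedField K] (g : K → K) (x : K) : ℕ :=
  if h : AnalyticAt K g x then (analyticOrderAt g x).toNat else 0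

/-- The radius `r(P_λ) = |1-λ|^{-1/p}·r̃(λ)` of quadratic linearization disks. -/
def rQuad {K : Type*} [NontriviallyNormedField K] (p : ℕ) (lam γ₀ : K) (m s t : ℕ) : ℝ :=
  ‖1 - lam‖ ^ (-(1 : ℝ) / (p : ℝ)) * rTilde p lam γ₀ m s t

/-- The quantity `Ψ(λ) = |1-λ|^{-1/p}·p^{-(s-t)/p^s}·|γ₀-λ|^{1/p^{s-t}}` (case `m = 1`). -/
def PsiL {K : Type*} [NontriviallyNormedField K] (p : ℕ) (lam γ₀ : K) (s t : ℕ) : ℝ :=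
  ‖1 - lam‖ ^ (-(1 : ℝ) / (p : ℝ)) *
    (p : ℝ) ^ (-(((s : ℝ) - (t : ℝ)) / (p : ℝ) ^ s)) *
    ‖γ₀ - lam‖ ^ ((1 : ℝ) / (p : ℝ) ^ ((s : ℝ) - (t : ℝ)))

/-- Coefficient sequence of the quadratic polynomial `P_λ(x) = λx + x²`. -/
def quadCoeff {K : Type*} [Field K] (lam : K) : ℕ → K :=
  fun i => if i = 1 then lam else if i = 2 then 1 else 0

/-- `δ(z) = (k-1)/z - ⌊(k-1)/z⌋` as a rational number. -/
def deltaFrac (k z : ℕ) : ℚ :=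
  ((k : ℚ) - 1) / (z : ℚ) - (((k - 1) / z : ℕ) : ℚ)

end

namespace QuadraticLinearization

/-! ### The radii `R(s)` -/

section Radii

variable {p : ℕ}

lemma Rr_succ (p j : ℕ) :
    Rr p (j + 1) = (p : ℝ) ^ (-(1 : ℝ) / ((p : ℝ) ^ j * ((p : ℝ) - 1))) := by
  simp [Rr]

lemma Rr_succ_pos (hp : 2 ≤ p) (j : ℕ) : 0 < Rr p (j + 1) := by
  rw [Rr_succ]
  have : (0 : ℝ) < p := by exact_mod_cast (by omega : 0 < p)
  positivity

lemma Rr_lt_Rr_succ (hp : 2 ≤ p) (j : ℕ) : Rr p j < Rr p (j + 1) := by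
  have hp1 : (1 : ℝ) < p := by exact_mod_cast (by omega : 1 < p)
  rcases j with _ | j
  · simpa [Rr] using Rr_succ_pos hp 0
  · rw [Rr_succ, Rr_succ]
    apply Real.rpow_lt_rpow_of_exponent_lt hp1
    have h1 : (0 : ℝ) < p ^ j * ((p : ℝ) - 1) := by
      have : (0 : ℝ) < (p : ℝ) - 1 := by linarith
      positivity
    rw [neg_div, neg_div, neg_lt_neg_iff]
    apply one_div_lt_one_div_of_lt h1
    rw [pow_succ]
    nlinarith

lemma Rr_strictMono (hp : 2 ≤ p) : StrictMono (Rr p) :=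
  strictMono_nat_of_lt_succ (Rr_lt_Rr_succ hp)

lemma Rr_lt_one (hp : 2 ≤ p) (j : ℕ) : Rr p j < 1 := by
  have hp1 : (1 : ℝ) < p := by exact_mod_cast (by omega : 1 < p)
  rcases j with _ | j
  · simp [Rr]
  · rw [Rr_succ]
    apply Real.rpow_lt_one_of_one_lt_of_neg hp1
    have : (0 : ℝ) < (p : ℝ) - 1 := by linarith
    rw [neg_div, neg_lt_zero]
    positivity

lemma Rr_succ_pow (hp : 2 ≤ p) (j : ℕ) : Rr p (j + 1) ^ p ^ j = Rr p 1 := by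
  have hp1 : (1 : ℝ) < p := by exact_mod_cast (by omega : 1 < p)
  have h1 : (p : ℝ) - 1 ≠ 0 := by linarith
  rw [Rr_succ, Rr_succ, ← Real.rpow_natCast, ← Real.rpow_mul (by linarith)]
  congr 1
  push_cast
  field_simp

lemma Rr_one_pow (hp : 2 ≤ p) : Rr p 1 ^ (p - 1) = (p : ℝ)⁻¹ := by
  have hp1 : (1 : ℝ) < p := by exact_mod_cast (by omega : 1 < p)
  have h1 : (p : ℝ) - 1 ≠ 0 := by linarith
  rw [Rr_succ, ← Real.rpow_natCast, ← Real.rpow_mul (by linarith), ← Real.rpow_neg_one]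
  congr 1
  rw [Nat.cast_sub (by omega)]
  push_cast
  field_simp

lemma Rr_interval_unique (hp : 2 ≤ p) {x : ℝ} {i j : ℕ} (hi : Rr p i ≤ x ∧ x < Rr p (i + 1))
    (hj : Rr p j ≤ x ∧ x < Rr p (j + 1)) : i = j := by
  have h1 := (Rr_strictMono hp).lt_iff_lt.1 (hi.1.trans_lt hj.2)
  have h2 := (Rr_strictMono hp).lt_iff_lt.1 (hj.1.trans_lt hi.2)
  omega

/-- Below the threshold index the iterated `p`-th powers of `x` stay at least `R(1)`. -/
lemma Rr_one_le_pow (hp : 2 ≤ p) {x : ℝ} {t v : ℕ} (hx : Rr p t ≤ x) (hx1 : x ≤ 1) (hv : v < t) :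
    Rr p 1 ≤ x ^ p ^ v := by
  obtain ⟨j, rfl⟩ : ∃ j, t = j + 1 := ⟨t - 1, by omega⟩
  have h0 := Rr_succ_pos hp j
  calc Rr p 1 = Rr p (j + 1) ^ p ^ j := (Rr_succ_pow hp j).symm
    _ ≤ x ^ p ^ j := pow_le_pow_left₀ h0.le hx _
    _ ≤ x ^ p ^ v := pow_le_pow_of_le_one (h0.le.trans hx) hx1
        (Nat.pow_le_pow_right (by omega) (by omega))

lemma pow_lt_Rr_one (hp : 2 ≤ p) {x : ℝ} {t : ℕ} (hx0 : 0 ≤ x) (hx : x < Rr p (t + 1)) :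
    x ^ p ^ t < Rr p 1 := by
  rw [← Rr_succ_pow hp t]
  exact pow_lt_pow_left₀ hx hx0 (pow_ne_zero _ (by omega))

end Radii

/-! ### Powers of elements close to `1` -/

section Powers

variable {K : Type*} [NontriviallyNormedField K] [IsUltrametricDist K]

lemma norm_sub_le_max' (x y z : K) : ‖x - z‖ ≤ max ‖x - y‖ ‖y - z‖ := by
  simpa using IsUltrametricDist.norm_add_le_max (x - y) (y - z)

lemma norm_add_eq_left_of_lt {x y : K} (h : ‖y‖ < ‖x‖) : ‖x + y‖ = ‖x‖ := by
  rw [IsUltrametricDist.norm_add_eq_max_of_norm_ne_norm h.ne', max_eq_left h.le]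

lemma norm_eq_one_of_norm_one_sub_lt_one {x : K} (h : ‖1 - x‖ < 1) : ‖x‖ = 1 := by
  have := norm_add_eq_left_of_lt (x := (1 : K)) (y := -(1 - x)) (by simpa [norm_sub_rev] using h)
  simpa using this

lemma norm_one_sub_pow_le {x : K} (hx : ‖x‖ ≤ 1) (c : ℕ) : ‖1 - x ^ c‖ ≤ ‖1 - x‖ := by
  rw [← mul_neg_geom_sum, norm_mul]
  refine mul_le_of_le_one_right (norm_nonneg _) ?_
  refine IsUltrametricDist.norm_sum_le_of_forall_le_of_nonneg zero_le_one fun i _ => ?_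
  rw [norm_pow]
  exact pow_le_one₀ (norm_nonneg _) hx

lemma norm_one_sub_pow_of_norm_natCast_eq_one {x : K} (hx : ‖1 - x‖ < 1) {c : ℕ}
    (hc : ‖(c : K)‖ = 1) : ‖1 - x ^ c‖ = ‖1 - x‖ := by
  have hx1 := norm_eq_one_of_norm_one_sub_lt_one hx
  rw [← mul_neg_geom_sum, norm_mul]
  have h : ∑ i ∈ Finset.range c, x ^ i = (c : K) + ∑ i ∈ Finset.range c, (x ^ i - 1) := by
    simp
  have h2 : ‖∑ i ∈ Finset.range c, (x ^ i - 1)‖ ≤ ‖1 - x‖ :=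
    IsUltrametricDist.norm_sum_le_of_forall_le_of_nonneg (norm_nonneg _) fun i _ => by
      rw [norm_sub_rev]
      exact norm_one_sub_pow_le hx1.le i
  rw [h, norm_add_eq_left_of_lt (by rw [hc]; exact h2.trans_lt hx), hc, mul_one]

lemma norm_aeval_int_le_one {y : K} (hy : ‖y‖ ≤ 1) (q : Polynomial ℤ) :
    ‖Polynomial.aeval y q‖ ≤ 1 := by
  rw [Polynomial.aeval_eq_sum_range]
  refine IsUltrametricDist.norm_sum_le_of_forall_le_of_nonneg zero_le_one fun i _ => ?_
  rw [zsmul_eq_mul, norm_mul, norm_pow]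
  exact mul_le_one₀ (IsUltrametricDist.norm_intCast_le_one K _) (by positivity)
    (pow_le_one₀ (norm_nonneg _) hy)

/-- The integral form of the binomial expansion of `x ^ p` around `1`. -/
lemma exists_pow_prime_expansion {p : ℕ} (hp : p.Prime) {x : K} (hx : ‖x‖ ≤ 1) :
    ∃ r : K, ‖r‖ ≤ 1 ∧ x ^ p - 1 = (x - 1) ^ p + p * (x - 1) * r := by
  obtain ⟨r, hr⟩ := exists_add_pow_prime_eq hp (1 : Polynomial ℤ) Polynomial.X
  have hy : ‖x - 1‖ ≤ 1 := by
    simpa [hx, sub_eq_add_neg] using IsUltrametricDist.norm_add_le_max x (-1)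
  refine ⟨Polynomial.aeval (x - 1) r, norm_aeval_int_le_one hy r, ?_⟩
  have := congrArg (Polynomial.aeval (x - 1)) hr
  simp only [map_pow, map_add, map_mul, map_one, Polynomial.aeval_X, map_natCast, one_pow] at this
  rw [add_sub_cancel] at this
  rw [this]
  ring

end Powers

/-! ### Distances to `p`-power roots of unity -/

section RootsOfUnity

variable {p : ℕ} {K : Type*} [NontriviallyNormedField K]

lemma mul_mem_GammaR {x y : K} (hx : x ∈ GammaR p K) (hy : y ∈ GammaR p K) :
    x * y ∈ GammaR p K := by
  obtain ⟨i, hi⟩ := hx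
  obtain ⟨j, hj⟩ := hy
  refine ⟨i + j, ?_⟩
  rw [mul_pow, pow_add, pow_mul, hi, one_pow, one_mul, mul_comm, pow_mul, hj, one_pow]

/-- `1` is a closest `p`-power root of unity to `η`. -/
def ClosestToOne (p : ℕ) (η : K) : Prop := ∀ γ ∈ GammaR p K, ‖1 - η‖ ≤ ‖γ - η‖

lemma ClosestToOne.norm_sub_eq [IsUltrametricDist K] {η γ : K} (h : ClosestToOne p η) (hγ : γ ∈ GammaR p K) :
    ‖γ - η‖ = max ‖1 - γ‖ ‖1 - η‖ := by
  have h1 := h γ hγ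
  refine le_antisymm ?_ (max_le ?_ h1)
  · rw [norm_sub_rev 1 γ]
    exact norm_sub_le_max' γ 1 η
  · refine (norm_sub_le_max' 1 η γ).trans (max_le h1 ?_)
    rw [norm_sub_rev]

variable [Fact p.Prime]

lemma norm_natCast_of_isometric [Algebra ℚ_[p] K] (hiso : ∀ x : ℚ_[p], ‖algebraMap ℚ_[p] K x‖ = ‖x‖)
    (n : ℕ) : ‖(n : K)‖ = ‖(n : ℚ_[p])‖ := by
  rw [← hiso, map_natCast]

lemma norm_natCast_prime (hnat : ∀ n : ℕ, ‖(n : K)‖ = ‖(n : ℚ_[p])‖) : ‖(p : K)‖ = (p : ℝ)⁻¹ := by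
  rw [hnat, Padic.norm_p]

lemma norm_natCast_of_not_dvd (hnat : ∀ n : ℕ, ‖(n : K)‖ = ‖(n : ℚ_[p])‖) {n : ℕ}
    (hn : ¬ p ∣ n) : ‖(n : K)‖ = 1 := by
  rw [hnat]
  rw [Padic.norm_natCast_eq_one_iff]
  exact (Nat.Prime.coprime_iff_not_dvd Fact.out).2 hn

lemma norm_eq_one_of_mem_GammaR {γ : K} (h : γ ∈ GammaR p K) : ‖γ‖ = 1 := by
  obtain ⟨k, hk⟩ := h
  have : ‖γ‖ ^ p ^ k = 1 := by rw [← norm_pow, hk, norm_one]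
  exact (pow_eq_one_iff_of_nonneg (norm_nonneg _)
    (pow_ne_zero _ (Fact.out : p.Prime).ne_zero)).1 this

lemma isPrimitiveRoot_of_pow_prime_eq_one {ζ : K} (h : ζ ^ p = 1) (h1 : ζ ≠ 1) :
    IsPrimitiveRoot ζ p := by
  rw [← orderOf_eq_prime h h1]
  exact IsPrimitiveRoot.orderOf ζ

lemma exists_primitiveRoot_prime [IsAlgClosed K]
    (hnat : ∀ n : ℕ, ‖(n : K)‖ = ‖(n : ℚ_[p])‖) :
    ∃ ζ : K, IsPrimitiveRoot ζ p := by
  have : NeZero (p : K) := ⟨by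
    rw [← norm_pos_iff, norm_natCast_prime hnat]
    have := (Fact.out : p.Prime).pos
    positivity⟩
  exact HasEnoughRootsOfUnity.exists_primitiveRoot K p

variable [IsUltrametricDist K]

lemma norm_natCast_of_dvd (hnat : ∀ n : ℕ, ‖(n : K)‖ = ‖(n : ℚ_[p])‖) {n : ℕ}
    (hn : p ∣ n) : ‖(n : K)‖ ≤ (p : ℝ)⁻¹ := by
  obtain ⟨c, rfl⟩ := hn
  rw [Nat.cast_mul, norm_mul, norm_natCast_prime hnat]
  exact mul_le_of_le_one_right (by positivity) (IsUltrametricDist.norm_natCast_le_one K c)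

lemma norm_one_sub_pow_prime_le (hnat : ∀ n : ℕ, ‖(n : K)‖ = ‖(n : ℚ_[p])‖) {x : K}
    (hx : ‖x‖ ≤ 1) : ‖1 - x ^ p‖ ≤ max (‖1 - x‖ ^ p) ((p : ℝ)⁻¹ * ‖1 - x‖) := by
  obtain ⟨r, hr, h⟩ := exists_pow_prime_expansion (Fact.out : p.Prime) hx
  rw [norm_sub_rev, h]
  refine (IsUltrametricDist.norm_add_le_max _ _).trans (max_le_max ?_ ?_)
  · rw [norm_pow, norm_sub_rev]
  · rw [norm_mul, norm_mul, norm_natCast_prime hnat, norm_sub_rev x]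
    exact mul_le_of_le_one_right (by positivity) hr

lemma norm_one_sub_pow_prime_of_lt (hnat : ∀ n : ℕ, ‖(n : K)‖ = ‖(n : ℚ_[p])‖) {x : K}
    (hx : ‖x‖ ≤ 1) (h1 : Rr p 1 < ‖1 - x‖) : ‖1 - x ^ p‖ = ‖1 - x‖ ^ p := by
  have hp2 : 2 ≤ p := (Fact.out : p.Prime).two_le
  obtain ⟨r, hr, h⟩ := exists_pow_prime_expansion (Fact.out : p.Prime) hx
  have hpos : 0 < ‖1 - x‖ := (Rr_succ_pos hp2 0).trans h1
  have hpow : (p : ℝ)⁻¹ < ‖1 - x‖ ^ (p - 1) := by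
    rw [← Rr_one_pow hp2]
    exact pow_lt_pow_left₀ h1 (Rr_succ_pos hp2 0).le (by omega)
  rw [norm_sub_rev, h, norm_add_eq_left_of_lt, norm_pow, norm_sub_rev]
  rw [norm_mul, norm_mul, norm_natCast_prime hnat, norm_pow, norm_sub_rev x]
  calc (p : ℝ)⁻¹ * ‖1 - x‖ * ‖r‖ ≤ (p : ℝ)⁻¹ * ‖1 - x‖ := mul_le_of_le_one_right (by positivity) hr
    _ < ‖1 - x‖ ^ (p - 1) * ‖1 - x‖ := by gcongr
    _ = ‖1 - x‖ ^ p := by rw [← pow_succ, Nat.sub_add_cancel (by omega)]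

lemma norm_one_sub_pow_prime_lt_of_le (hnat : ∀ n : ℕ, ‖(n : K)‖ = ‖(n : ℚ_[p])‖) {x : K}
    (hx : ‖x‖ ≤ 1) (h1 : ‖1 - x‖ ≤ Rr p 1) : ‖1 - x ^ p‖ < Rr p 1 := by
  have hp2 : 2 ≤ p := (Fact.out : p.Prime).two_le
  have hR := Rr_succ_pos hp2 0
  have hR1 := Rr_lt_one hp2 1
  refine (norm_one_sub_pow_prime_le hnat hx).trans_lt (max_lt ?_ ?_)
  · calc ‖1 - x‖ ^ p ≤ Rr p 1 ^ p := by gcongr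
      _ < Rr p 1 ^ 1 := pow_lt_pow_right_of_lt_one₀ hR hR1 (by omega)
      _ = Rr p 1 := pow_one _
  · have hpinv : (p : ℝ)⁻¹ < 1 := inv_lt_one_of_one_lt₀ (by exact_mod_cast (by omega : 1 < p))
    calc (p : ℝ)⁻¹ * ‖1 - x‖ ≤ (p : ℝ)⁻¹ * Rr p 1 := by gcongr
      _ < 1 * Rr p 1 := by gcongr
      _ = Rr p 1 := one_mul _

lemma norm_one_sub_lt_one_of_pow_prime (hnat : ∀ n : ℕ, ‖(n : K)‖ = ‖(n : ℚ_[p])‖) {x : K}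
    (hx : ‖x‖ ≤ 1) (h1 : ‖1 - x ^ p‖ < 1) : ‖1 - x‖ < 1 := by
  have hp2 : 2 ≤ p := (Fact.out : p.Prime).two_le
  by_contra! h
  have := norm_one_sub_pow_prime_of_lt hnat hx ((Rr_lt_one hp2 1).trans_le h)
  rw [this] at h1
  exact absurd h1 (not_lt.2 (one_le_pow₀ h))

lemma norm_one_sub_primitiveRoot (hnat : ∀ n : ℕ, ‖(n : K)‖ = ‖(n : ℚ_[p])‖) {ζ : K}
    (hζ : IsPrimitiveRoot ζ p) : ‖1 - ζ‖ = Rr p 1 := by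
  have hp : p.Prime := Fact.out
  have hζ1 : ‖ζ‖ = 1 := norm_eq_one_of_mem_GammaR (p := p) ⟨1, by simpa using hζ.pow_eq_one⟩
  have hlt : ‖1 - ζ‖ < 1 :=
    norm_one_sub_lt_one_of_pow_prime hnat hζ1.le (by simp [hζ.pow_eq_one])
  have key : (p : K) = ∏ μ ∈ primitiveRoots p K, (1 - μ) := by
    rw [← Polynomial.eval_one_cyclotomic_prime (R := K) (p := p),
      Polynomial.cyclotomic_eq_prod_X_sub_primitiveRoots hζ, Polynomial.eval_prod]
    simp
  have h2 : (p : ℝ)⁻¹ = ‖1 - ζ‖ ^ (p - 1) := by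
    rw [← norm_natCast_prime hnat, key, norm_prod]
    have : ∀ μ ∈ primitiveRoots p K, ‖1 - μ‖ = ‖1 - ζ‖ := fun μ hμ => by
      have hμ' := isPrimitiveRoot_of_mem_primitiveRoots hμ
      obtain ⟨i, -, rfl⟩ := hζ.eq_pow_of_pow_eq_one hμ'.pow_eq_one
      refine norm_one_sub_pow_of_norm_natCast_eq_one hlt (norm_natCast_of_not_dvd hnat ?_)
      intro hd
      exact hμ'.ne_one hp.one_lt ((hζ.pow_eq_one_iff_dvd i).2 hd)
    rw [Finset.prod_congr rfl this, Finset.prod_const, hζ.card_primitiveRoots,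
      Nat.totient_prime hp]
  rw [← Rr_one_pow hp.two_le] at h2
  exact (pow_left_inj₀ (norm_nonneg _) (Rr_succ_pos hp.two_le 0).le
    (by have := hp.two_le; omega)).1 h2.symm

lemma norm_one_sub_of_order_pow (hnat : ∀ n : ℕ, ‖(n : K)‖ = ‖(n : ℚ_[p])‖) (j : ℕ) :
    ∀ {ζ : K}, ζ ^ p ^ (j + 1) = 1 → ζ ^ p ^ j ≠ 1 → ‖1 - ζ‖ = Rr p (j + 1) := by
  have hp : p.Prime := Fact.out
  induction j with
  | zero =>
    intro ζ h h1
    exact norm_one_sub_primitiveRoot hnat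
      (isPrimitiveRoot_of_pow_prime_eq_one (by simpa using h) (by simpa using h1))
  | succ j ih =>
    intro ζ h h1
    have hζ1 : ‖ζ‖ = 1 := norm_eq_one_of_mem_GammaR (p := p) ⟨_, h⟩
    have h2 : ‖1 - ζ ^ p‖ = Rr p (j + 1) := by
      apply ih
      · rw [← pow_mul, ← pow_succ', h]
      · rwa [← pow_mul, ← pow_succ']
    have h3 : Rr p 1 < ‖1 - ζ‖ := by
      by_contra! hle
      have := norm_one_sub_pow_prime_lt_of_le hnat hζ1.le hle
      rw [h2] at this
      exact absurd this (not_lt.2 ((Rr_strictMono hp.two_le).monotone (by omega)))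
    rw [norm_one_sub_pow_prime_of_lt hnat hζ1.le h3] at h2
    have h4 : Rr p (j + 1 + 1) ^ p = Rr p (j + 1) := by
      have e1 := Rr_succ_pow hp.two_le (j + 1)
      rw [pow_succ', pow_mul, ← Rr_succ_pow hp.two_le j] at e1
      exact (pow_left_inj₀ (pow_nonneg (Rr_succ_pos hp.two_le _).le _)
        (Rr_succ_pos hp.two_le _).le (pow_ne_zero _ hp.ne_zero)).1 e1
    rw [← h4] at h2
    exact (pow_left_inj₀ (norm_nonneg _) (Rr_succ_pos hp.two_le _).le hp.ne_zero).1 h2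

variable [IsAlgClosed K]

lemma ClosestToOne.norm_one_sub_pow (hnat : ∀ n : ℕ, ‖(n : K)‖ = ‖(n : ℚ_[p])‖) {η : K}
    (h : ClosestToOne p η) : ‖1 - η ^ p‖ = ‖1 - η‖ * max (Rr p 1) ‖1 - η‖ ^ (p - 1) := by
  classical
  have hp : p.Prime := Fact.out
  obtain ⟨ζ, hζ⟩ := exists_primitiveRoot_prime (p := p) (K := K) hnat
  have hprod := hζ.pow_sub_pow_eq_prod_sub_mul η 1 hp.pos
  have h1mem : (1 : K) ∈ Polynomial.nthRootsFinset p (1 : K) :=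
    Polynomial.one_mem_nthRootsFinset hp.pos
  rw [one_pow] at hprod
  rw [norm_sub_rev, hprod, norm_prod, ← Finset.mul_prod_erase _ _ h1mem]
  congr 1
  · rw [mul_one, norm_sub_rev]
  · rw [Finset.prod_congr rfl (g := fun _ => max (Rr p 1) ‖1 - η‖), Finset.prod_const,
      Finset.card_erase_of_mem h1mem, hζ.card_nthRootsFinset]
    intro μ hμ
    rw [Finset.mem_erase, Polynomial.mem_nthRootsFinset hp.pos] at hμ
    rw [mul_one, norm_sub_rev, h.norm_sub_eq ⟨1, by simpa using hμ.2⟩,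
      norm_one_sub_primitiveRoot hnat (isPrimitiveRoot_of_pow_prime_eq_one hμ.2 hμ.1)]

lemma ClosestToOne.pow (hnat : ∀ n : ℕ, ‖(n : K)‖ = ‖(n : ℚ_[p])‖) {η : K}
    (h : ClosestToOne p η) : ClosestToOne p (η ^ p) := by
  have hp : p.Prime := Fact.out
  obtain ⟨ζ, hζ⟩ := exists_primitiveRoot_prime (p := p) (K := K) hnat
  rintro γ ⟨k, hk⟩
  obtain ⟨δ', hδ'⟩ := IsAlgClosed.exists_pow_nat_eq γ hp.pos
  obtain ⟨ω, hω, hmin⟩ := Finset.exists_min_image (Polynomial.nthRootsFinset p (1 : K))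
    (fun ω => ‖1 - ω * δ'‖) ⟨1, Polynomial.one_mem_nthRootsFinset hp.pos⟩
  rw [Polynomial.mem_nthRootsFinset hp.pos] at hω
  set δ := ω * δ' with hδdef
  have hδ : δ ^ p = γ := by rw [mul_pow, hω, one_mul, hδ']
  have hδmin : ∀ μ ∈ Polynomial.nthRootsFinset p (1 : K), ‖1 - δ‖ ≤ ‖1 - μ * δ‖ := fun μ hμ => by
    rw [Polynomial.mem_nthRootsFinset hp.pos] at hμ
    have := hmin (μ * ω) (by rw [Polynomial.mem_nthRootsFinset hp.pos, mul_pow, hμ, hω, one_mul])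
    rwa [mul_assoc] at this
  have hδΓ : δ ∈ GammaR p K := ⟨k + 1, by rw [pow_succ', pow_mul, hδ, hk]⟩
  have e1 := hζ.pow_sub_pow_eq_prod_sub_mul η δ hp.pos
  have e2 := hζ.pow_sub_pow_eq_prod_sub_mul η 1 hp.pos
  rw [one_pow] at e2
  rw [norm_sub_rev, norm_sub_rev γ, ← hδ, e1, e2, norm_prod, norm_prod]
  refine Finset.prod_le_prod (fun _ _ => norm_nonneg _) fun μ hμ => ?_
  have hμp := (Polynomial.mem_nthRootsFinset hp.pos (1 : K)).1 hμ
  have hμΓ : μ ∈ GammaR p K := ⟨1, by simpa using hμp⟩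
  rw [mul_one, norm_sub_rev, h.norm_sub_eq hμΓ, norm_sub_rev η,
    h.norm_sub_eq (mul_mem_GammaR hμΓ hδΓ)]
  refine max_le_max ?_ le_rfl
  refine (norm_sub_le_max' 1 (μ * δ) μ).trans (max_le le_rfl ?_)
  have : ‖μ * δ - μ‖ = ‖1 - δ‖ := by
    rw [← mul_sub_one, norm_mul, norm_eq_one_of_mem_GammaR hμΓ, one_mul, norm_sub_rev]
  rw [this]
  exact hδmin μ hμ

lemma ClosestToOne.iterate (hnat : ∀ n : ℕ, ‖(n : K)‖ = ‖(n : ℚ_[p])‖) {η : K}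
    (h : ClosestToOne p η) (v : ℕ) : ClosestToOne p (η ^ p ^ v) := by
  induction v with
  | zero => simpa using h
  | succ v ih =>
    rw [pow_succ, pow_mul]
    exact ih.pow hnat

lemma ClosestToOne.norm_one_sub_pow_of_le (hnat : ∀ n : ℕ, ‖(n : K)‖ = ‖(n : ℚ_[p])‖) {η : K}
    (h : ClosestToOne p η) {t : ℕ} (ht : Rr p t ≤ ‖1 - η‖) (h1 : ‖1 - η‖ ≤ 1) (v : ℕ)
    (hv : v ≤ t) : ‖1 - η ^ p ^ v‖ = ‖1 - η‖ ^ p ^ v := by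
  have hp : p.Prime := Fact.out
  induction v with
  | zero => simp
  | succ v ih =>
    have ih' := ih (by omega)
    rw [pow_succ, pow_mul, (h.iterate hnat v).norm_one_sub_pow hnat, ih',
      max_eq_right (Rr_one_le_pow hp.two_le ht h1 (by omega)), ← pow_succ',
      Nat.sub_add_cancel hp.one_le, ← pow_mul]

lemma ClosestToOne.norm_one_sub_pow_add (hnat : ∀ n : ℕ, ‖(n : K)‖ = ‖(n : ℚ_[p])‖) {η : K}
    (h : ClosestToOne p η) {t : ℕ} (ht : Rr p t ≤ ‖1 - η‖ ∧ ‖1 - η‖ < Rr p (t + 1)) (j : ℕ) :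
    ‖1 - η ^ p ^ (t + j)‖ = ‖1 - η‖ ^ p ^ t * ((p : ℝ)⁻¹) ^ j := by
  have hp : p.Prime := Fact.out
  have hp1 : (p : ℝ)⁻¹ ≤ 1 := inv_le_one_of_one_le₀ (by exact_mod_cast hp.one_le)
  induction j with
  | zero =>
    simpa using h.norm_one_sub_pow_of_le hnat ht.1 (ht.2.trans (Rr_lt_one hp.two_le _)).le t le_rfl
  | succ j ih =>
    have hle : ‖1 - η‖ ^ p ^ t * ((p : ℝ)⁻¹) ^ j ≤ Rr p 1 :=
      (mul_le_of_le_one_right (by positivity) (pow_le_one₀ (by positivity) hp1)).trans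
        (pow_lt_Rr_one hp.two_le (norm_nonneg _) ht.2).le
    rw [← add_assoc, pow_succ p, pow_mul, (h.iterate hnat (t + j)).norm_one_sub_pow hnat, ih,
      max_eq_left hle, Rr_one_pow hp.two_le, pow_succ ((p : ℝ)⁻¹), mul_assoc]

/-- The exact values of `|1 - λ ^ (p ^ v)|` in terms of the parameters `s`, `t`, `γ₀`. -/
lemma norm_one_sub_pow_prime_pow (hnat : ∀ n : ℕ, ‖(n : K)‖ = ‖(n : ℚ_[p])‖) {lam γ₀ : K}
    {s t : ℕ} (hs : Rr p s ≤ ‖1 - lam‖ ∧ ‖1 - lam‖ < Rr p (s + 1)) (hγ₀ : γ₀ ∈ GammaR p K)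
    (hγmin : ∀ γ ∈ GammaR p K, ‖γ₀ - lam‖ ≤ ‖γ - lam‖)
    (ht : Rr p t ≤ ‖γ₀ - lam‖ ∧ ‖γ₀ - lam‖ < Rr p (t + 1)) :
    t ≤ s ∧ (∀ v < s, ‖1 - lam ^ p ^ v‖ = ‖1 - lam‖ ^ p ^ v) ∧
      ∀ j, ‖1 - lam ^ p ^ (s + j)‖ = ‖γ₀ - lam‖ ^ p ^ t * ((p : ℝ)⁻¹) ^ (s - t + j) := by
  have hp : p.Prime := Fact.out
  have hlt1 : ‖1 - lam‖ < 1 := hs.2.trans (Rr_lt_one hp.two_le _)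
  have hlam : ‖lam‖ = 1 := norm_eq_one_of_norm_one_sub_lt_one hlt1
  have hle : ‖γ₀ - lam‖ ≤ ‖1 - lam‖ := hγmin 1 ⟨0, by simp⟩
  rcases hle.eq_or_lt with heq | hlt
  · have hcl : ClosestToOne p lam := fun γ hγ => heq ▸ hγmin γ hγ
    rw [heq] at ht ⊢
    obtain rfl := Rr_interval_unique hp.two_le hs ht
    refine ⟨le_rfl, fun v hv => hcl.norm_one_sub_pow_of_le hnat hs.1 hlt1.le v hv.le, fun j => ?_⟩
    rw [hcl.norm_one_sub_pow_add hnat hs j]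
    simp
  · have hγ1 := norm_eq_one_of_mem_GammaR hγ₀
    have hγ0 : γ₀ ≠ 0 := by rintro rfl; simp at hγ1
    have hdist : ‖1 - γ₀‖ = ‖1 - lam‖ := by
      have : 1 - γ₀ = (1 - lam) + -(γ₀ - lam) := by ring
      rw [this, norm_add_eq_left_of_lt (by rwa [norm_neg])]
    have hne1 : γ₀ ≠ 1 := by
      rintro rfl
      exact hlt.ne rfl
    classical
    have hfind := Nat.find_spec hγ₀
    have hfpos : Nat.find hγ₀ ≠ 0 := fun h0 => by
      rw [h0] at hfind
      exact hne1 (by simpa using hfind)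
    obtain ⟨j, hj⟩ := Nat.exists_eq_succ_of_ne_zero hfpos
    rw [hj] at hfind
    have hRj : ‖1 - γ₀‖ = Rr p (j + 1) :=
      norm_one_sub_of_order_pow hnat j hfind (Nat.find_min hγ₀ (by omega))
    have hsj : s = j + 1 := by
      refine Rr_interval_unique hp.two_le hs ⟨?_, ?_⟩
      · rw [← hdist, hRj]
      · rw [← hdist, hRj]
        exact Rr_lt_Rr_succ hp.two_le _
    subst hsj
    have hts : t < j + 1 :=
      (Rr_strictMono hp.two_le).lt_iff_lt.1 (ht.1.trans_lt (by rwa [← hRj, hdist]))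
    refine ⟨hts.le, fun v hv => ?_, fun i => ?_⟩
    · induction v with
      | zero => simp
      | succ v ih =>
        have ih' := ih (by omega)
        have hbig : Rr p 1 < ‖1 - lam ^ p ^ v‖ := by
          rw [ih', ← Rr_succ_pow hp.two_le j]
          calc Rr p (j + 1) ^ p ^ j < Rr p (j + 1) ^ p ^ v :=
                pow_lt_pow_right_of_lt_one₀ (Rr_succ_pos hp.two_le j) (Rr_lt_one hp.two_le _)
                  (Nat.pow_lt_pow_right hp.one_lt (by omega))
            _ ≤ _ := pow_le_pow_left₀ (Rr_succ_pos hp.two_le j).le hs.1 _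
        rw [pow_succ, pow_mul, norm_one_sub_pow_prime_of_lt hnat (by simp [hlam]) hbig, ih',
          ← pow_mul]
    · have hη : ∀ γ : K, ‖γ - γ₀⁻¹ * lam‖ = ‖γ₀ * γ - lam‖ := fun γ => by
        have : γ₀ * γ - lam = γ₀ * (γ - γ₀⁻¹ * lam) := by field_simp
        rw [this, norm_mul, hγ1, one_mul]
      have hη1 : ‖1 - γ₀⁻¹ * lam‖ = ‖γ₀ - lam‖ := by rw [hη, mul_one]
      have hcl : ClosestToOne p (γ₀⁻¹ * lam) := fun γ hγ => by
        rw [hη1, hη]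
        exact hγmin _ (mul_mem_GammaR hγ₀ hγ)
      have hpow : (γ₀⁻¹ * lam) ^ p ^ (j + 1 + i) = lam ^ p ^ (j + 1 + i) := by
        rw [mul_pow, pow_add p, pow_mul γ₀⁻¹, inv_pow, hfind]
        simp
      have := hcl.norm_one_sub_pow_add hnat (t := t) (by rwa [hη1]) (j + 1 - t + i)
      rw [hη1, show t + (j + 1 - t + i) = j + 1 + i by omega, hpow] at this
      exact this

end RootsOfUnity

/-! ### The coefficients of the conjugacy -/

section Coefficients

variable {K : Type*}

lemma coeff_mk_quadCoeff_pow [Field K] (lam : K) (l k : ℕ) :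
    PowerSeries.coeff k ((PowerSeries.mk (quadCoeff lam)) ^ l) =
      if l ≤ k then lam ^ (l - (k - l)) * (l.choose (k - l) : K) else 0 := by
  have h : PowerSeries.mk (quadCoeff lam) =
      PowerSeries.X * ((Polynomial.X + Polynomial.C lam : Polynomial K) : PowerSeries K) := by
    ext n
    rcases n with _ | _ | _ | n
    · simp [quadCoeff]
    · simp [quadCoeff, PowerSeries.coeff_succ_X_mul]
    · simp [quadCoeff, PowerSeries.coeff_succ_X_mul]
    · simp [quadCoeff, PowerSeries.coeff_succ_X_mul, PowerSeries.coeff_X]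
  rw [h, mul_pow, PowerSeries.coeff_X_pow_mul', ← Polynomial.coe_pow, Polynomial.coeff_coe,
    Polynomial.coeff_X_add_C_pow]

lemma conjugacy_recursion [Field K] {lam : K} {b : ℕ → K}
    (hb : IsConjugacy lam (quadCoeff lam) b) (n : ℕ) :
    lam * (1 - lam ^ n) * b (n + 1) = ∑ l ∈ Finset.range (n + 1),
      b l * PowerSeries.coeff (n + 1) ((PowerSeries.mk (quadCoeff lam)) ^ l) := by
  have h := hb.2.2 (n + 1)
  rw [compCoeff, Finset.sum_range_succ, coeff_mk_quadCoeff_pow lam (n + 1) (n + 1)] at h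
  simp only [le_refl, if_true, Nat.sub_self, Nat.sub_zero, Nat.choose_zero_right, Nat.cast_one,
    mul_one] at h
  rw [← sub_eq_iff_eq_add.2 h.symm]
  ring

/-- The formal linearizing conjugacy is unique when `λ` is neither zero nor a root of unity. -/
lemma conjugacy_unique [Field K] {lam : K} (hlam : lam ≠ 0)
    (hroot : ∀ n : ℕ, 1 ≤ n → lam ^ n ≠ 1) {b b' : ℕ → K}
    (hb : IsConjugacy lam (quadCoeff lam) b) (hb' : IsConjugacy lam (quadCoeff lam) b') :
    b = b' := by
  funext k
  induction k using Nat.strong_induction_on with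
  | _ k ih =>
    rcases k with _ | _ | n
    · rw [hb.1, hb'.1]
    · rw [hb.2.1, hb'.2.1]
    · have h1 := conjugacy_recursion hb (n + 1)
      rw [Finset.sum_congr rfl fun l hl => by rw [ih l (Finset.mem_range.1 hl)],
        ← conjugacy_recursion hb' (n + 1)] at h1
      refine mul_left_cancel₀ (mul_ne_zero hlam ?_) h1
      exact sub_ne_zero.2 (hroot (n + 1) (by omega)).symm

variable [NontriviallyNormedField K]

lemma norm_choose_two_eq_one {p : ℕ} [Fact p.Prime]
    (hnat : ∀ n : ℕ, ‖(n : K)‖ = ‖(n : ℚ_[p])‖) (hp3 : 3 ≤ p) {n : ℕ}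
    (h0 : n ≠ 0) (hn : p ∣ n) : ‖((n - 1).choose 2 : K)‖ = 1 := by
  have hp : p.Prime := Fact.out
  have hpn := Nat.le_of_dvd (by omega) hn
  apply norm_natCast_of_not_dvd hnat
  intro hd
  have h2 : p ∣ (n - 1) * (n - 2) := by
    have h4 := Nat.choose_two_right (n - 1)
    have h5 : 2 ∣ (n - 1) * (n - 1 - 1) := (Nat.even_mul_pred_self (n - 1)).two_dvd
    have h6 : (n - 1) * (n - 2) = (n - 1).choose 2 * 2 := by
      rw [h4, Nat.div_mul_cancel h5, Nat.sub_sub]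
    rw [h6]
    exact dvd_mul_of_dvd_left hd 2
  rcases (hp.dvd_mul).1 h2 with h | h
  · have := (Nat.dvd_sub hn h)
    rw [show n - (n - 1) = 1 by omega] at this
    exact hp.one_lt.ne' (Nat.dvd_one.1 this)
  · have := (Nat.dvd_sub hn h)
    rw [show n - (n - 2) = 2 by omega] at this
    have := Nat.le_of_dvd (by omega) this
    omega

variable [IsUltrametricDist K]

lemma norm_coeff_mk_quadCoeff_pow_le {lam : K} (hlam : ‖lam‖ ≤ 1) (l k : ℕ) :
    ‖PowerSeries.coeff k ((PowerSeries.mk (quadCoeff lam)) ^ l)‖ ≤ 1 := by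
  rw [coeff_mk_quadCoeff_pow]
  split_ifs
  · rw [norm_mul, norm_pow]
    exact mul_le_one₀ (pow_le_one₀ (norm_nonneg _) hlam) (norm_nonneg _)
      (IsUltrametricDist.norm_natCast_le_one K _)
  · simp

lemma norm_sum_eq_of_dominant {ι : Type*} {S : Finset ι} {f : ι → K} {i : ι} (hi : i ∈ S)
    (h : ∀ j ∈ S, j ≠ i → ‖f j‖ < ‖f i‖) : ‖∑ j ∈ S, f j‖ = ‖f i‖ := by
  classical
  rw [← Finset.add_sum_erase _ _ hi]
  rcases (S.erase i).eq_empty_or_nonempty with he | hne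
  · simp [he]
  · obtain ⟨j, hj, hle⟩ := IsUltrametricDist.exists_norm_finsetSum_le_of_nonempty hne f
    rw [Finset.mem_erase] at hj
    exact norm_add_eq_left_of_lt (hle.trans_lt (h j hj.2 hj.1))

variable {p : ℕ} [Fact p.Prime]

lemma norm_one_sub_pow_lt_of_dvd (hnat : ∀ n : ℕ, ‖(n : K)‖ = ‖(n : ℚ_[p])‖) {lam : K}
    (h0 : 0 < ‖1 - lam‖) (h1 : ‖1 - lam‖ < 1) {n : ℕ} (hn : p ∣ n) :
    ‖1 - lam ^ n‖ < ‖1 - lam‖ := by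
  have hp : p.Prime := Fact.out
  have hlam := norm_eq_one_of_norm_one_sub_lt_one h1
  obtain ⟨c, rfl⟩ := hn
  rw [pow_mul]
  refine (norm_one_sub_pow_le (by simp [hlam]) c).trans_lt
    ((norm_one_sub_pow_prime_le hnat hlam.le).trans_lt (max_lt ?_ ?_))
  · simpa using pow_lt_pow_right_of_lt_one₀ h0 h1 hp.one_lt
  · exact mul_lt_of_lt_one_left h0 (inv_lt_one_of_one_lt₀ (by exact_mod_cast hp.one_lt))

/-- The exact growth of the coefficients of the conjugacy of `λ x + x ^ 2`. -/
lemma norm_conjugacy_succ (hp3 : 3 ≤ p) (hnat : ∀ n : ℕ, ‖(n : K)‖ = ‖(n : ℚ_[p])‖) {lam : K}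
    (hroot : ∀ n : ℕ, 1 ≤ n → lam ^ n ≠ 1) (hlam1 : 1 / (p : ℝ) < ‖1 - lam‖)
    (hlam2 : ‖1 - lam‖ < 1) {b : ℕ → K} (hb : IsConjugacy lam (quadCoeff lam) b) (n : ℕ) :
    ‖b n‖ < ‖b (n + 1)‖ ∧
      ‖b (n + 1)‖ * ‖1 - lam ^ n‖ = ‖b n‖ * (if p ∣ n then ‖1 - lam‖ else 1) := by
  have hp : p.Prime := Fact.out
  have hμ : 0 < ‖1 - lam‖ := lt_of_le_of_lt (by positivity) hlam1
  have hlam : ‖lam‖ = 1 := norm_eq_one_of_norm_one_sub_lt_one hlam2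
  induction n using Nat.strong_induction_on with
  | _ n ih =>
    rcases Nat.eq_zero_or_pos n with rfl | hn
    · simp [hb.1, hb.2.1]
    have hmono : ∀ k ≤ n, ∀ l < k, ‖b l‖ < ‖b k‖ := fun k hkn l hl => by
      induction k, hl using Nat.le_induction with
      | base => exact (ih l hkn).1
      | succ k hk ih2 => exact (ih2 (by omega)).trans (ih k hkn).1
    have hA : 0 < ‖1 - lam ^ n‖ := norm_pos_iff.2 (sub_ne_zero.2 (hroot n hn).symm)
    have hrec := congrArg norm (conjugacy_recursion hb n)
    rw [norm_mul, norm_mul, hlam, one_mul] at hrec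
    have hcoeff : ∀ l, ‖b l * PowerSeries.coeff (n + 1)
        ((PowerSeries.mk (quadCoeff lam)) ^ l)‖ ≤ ‖b l‖ := fun l => by
      rw [norm_mul]
      exact mul_le_of_le_one_right (norm_nonneg _) (norm_coeff_mk_quadCoeff_pow_le hlam.le _ _)
    have htop : ‖PowerSeries.coeff (n + 1) ((PowerSeries.mk (quadCoeff lam)) ^ n)‖
        = ‖(n : K)‖ := by
      rw [coeff_mk_quadCoeff_pow, if_pos (by omega), norm_mul, norm_pow, hlam, one_pow, one_mul,
        Nat.add_sub_cancel_left, Nat.choose_one_right]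
    by_cases hd : p ∣ n
    · have hpn := Nat.le_of_dvd hn hd
      have hnd : ¬ p ∣ n - 1 := fun h => by
        have := Nat.dvd_sub hd h
        rw [show n - (n - 1) = 1 by omega] at this
        exact hp.one_lt.ne' (Nat.dvd_one.1 this)
      have hprev := (ih (n - 1) (by omega)).2
      rw [if_neg hnd, mul_one, Nat.sub_add_cancel (by omega),
        norm_one_sub_pow_of_norm_natCast_eq_one hlam2 (norm_natCast_of_not_dvd hnat hnd)] at hprev
      have hterm : ‖b (n - 1) * PowerSeries.coeff (n + 1)
          ((PowerSeries.mk (quadCoeff lam)) ^ (n - 1))‖ = ‖b (n - 1)‖ := by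
        rw [norm_mul, coeff_mk_quadCoeff_pow, if_pos (by omega), norm_mul, norm_pow, hlam,
          one_pow, one_mul, show n + 1 - (n - 1) = 2 by omega,
          norm_choose_two_eq_one hnat hp3 (by omega) hd, mul_one]
      have hbn : 0 < ‖b n‖ := (norm_nonneg _).trans_lt (hmono n le_rfl 0 hn)
      have hsum := norm_sum_eq_of_dominant (S := Finset.range (n + 1)) (f := fun l => b l *
          PowerSeries.coeff (n + 1) ((PowerSeries.mk (quadCoeff lam)) ^ l)) (i := n - 1)
          (Finset.mem_range.2 (by omega)) (fun l hl hne => by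
        rw [Finset.mem_range] at hl
        rw [hterm]
        rcases (Nat.lt_succ_iff.1 hl).eq_or_lt with rfl | hlt
        · rw [norm_mul, htop, ← hprev]
          refine mul_lt_mul_of_pos_left ((norm_natCast_of_dvd hnat hd).trans_lt ?_) hbn
          rwa [← one_div]
        · refine (hcoeff l).trans_lt ?_
          exact hmono (n - 1) (by omega) l (by omega))
      rw [hsum, hterm, ← hprev] at hrec
      rw [if_pos hd]
      have hlt := norm_one_sub_pow_lt_of_dvd hnat hμ hlam2 hd
      refine ⟨?_, by rw [← hrec, mul_comm]⟩
      by_contra! hle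
      have : ‖1 - lam ^ n‖ * ‖b (n + 1)‖ < ‖1 - lam‖ * ‖b n‖ :=
        (mul_le_mul_of_nonneg_left hle hA.le).trans_lt (mul_lt_mul_of_pos_right hlt hbn)
      rw [hrec, mul_comm] at this
      exact lt_irrefl _ this
    · have hn1 := norm_natCast_of_not_dvd hnat hd
      have hterm : ‖b n * PowerSeries.coeff (n + 1)
          ((PowerSeries.mk (quadCoeff lam)) ^ n)‖ = ‖b n‖ := by
        rw [norm_mul, htop, hn1, mul_one]
      have hbn : 0 < ‖b n‖ := (norm_nonneg _).trans_lt (hmono n le_rfl 0 hn)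
      have hsum := norm_sum_eq_of_dominant (S := Finset.range (n + 1)) (f := fun l => b l *
          PowerSeries.coeff (n + 1) ((PowerSeries.mk (quadCoeff lam)) ^ l)) (i := n)
          (Finset.mem_range.2 (by omega)) (fun l hl hne => by
        rw [Finset.mem_range] at hl
        rw [hterm]
        exact (hcoeff l).trans_lt (hmono n le_rfl l (by omega)))
      rw [hsum, hterm] at hrec
      rw [if_neg hd, mul_one]
      refine ⟨?_, by rw [← hrec, mul_comm]⟩
      have hA1 : ‖1 - lam ^ n‖ < 1 := (norm_one_sub_pow_le hlam.le n).trans_lt hlam2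
      rw [← hrec]
      exact mul_lt_of_lt_one_left
        (pos_of_mul_pos_right (hrec ▸ hbn) hA.le) hA1

lemma log_norm_one_sub_pow (hnat : ∀ n : ℕ, ‖(n : K)‖ = ‖(n : ℚ_[p])‖) {lam : K}
    (hlam2 : ‖1 - lam‖ < 1) {V n : ℕ} (hn : n ≠ 0) (hnV : n < p ^ (V + 1)) :
    Real.log ‖1 - lam ^ n‖ = Real.log ‖1 - lam‖ + ∑ v ∈ Finset.range V,
      if p ^ (v + 1) ∣ n then
        Real.log ‖1 - lam ^ p ^ (v + 1)‖ - Real.log ‖1 - lam ^ p ^ v‖ else 0 := by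
  have hp : p.Prime := Fact.out
  have hlam := norm_eq_one_of_norm_one_sub_lt_one hlam2
  obtain ⟨w, c, hc, rfl⟩ := Nat.exists_eq_pow_mul_and_not_dvd hn p hp.ne_one
  have hwV : w ≤ V := by
    have h1 : p ^ w ≤ p ^ w * c := Nat.le_mul_of_pos_right _ (by
      rcases Nat.eq_zero_or_pos c with rfl | h
      · simp at hc
      · exact h)
    have := (Nat.pow_lt_pow_iff_right hp.one_lt).1 (h1.trans_lt hnV)
    omega
  have hdvd : ∀ v, p ^ (v + 1) ∣ p ^ w * c ↔ v < w := fun v => by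
    constructor
    · intro h
      by_contra! hle
      have h2 : p ^ w * p ∣ p ^ w * c := by
        rw [← pow_succ]
        exact (pow_dvd_pow p (by omega)).trans h
      exact hc (Nat.dvd_of_mul_dvd_mul_left (pow_pos hp.pos w) h2)
    · intro h
      exact dvd_mul_of_dvd_left (pow_dvd_pow p (by omega)) c
  have hnorm : ‖1 - lam ^ (p ^ w * c)‖ = ‖1 - lam ^ p ^ w‖ := by
    rw [pow_mul]
    exact norm_one_sub_pow_of_norm_natCast_eq_one
      ((norm_one_sub_pow_le hlam.le _).trans_lt hlam2) (norm_natCast_of_not_dvd hnat hc)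
  have hfilter : (Finset.range V).filter (fun v => v < w) = Finset.range w := by
    ext v
    simp only [Finset.mem_filter, Finset.mem_range]
    omega
  simp only [hdvd]
  rw [hnorm, ← Finset.sum_filter, hfilter,
    Finset.sum_range_sub (fun v => Real.log ‖1 - lam ^ p ^ v‖)]
  simp

lemma log_norm_conjugacy (hp3 : 3 ≤ p) (hnat : ∀ n : ℕ, ‖(n : K)‖ = ‖(n : ℚ_[p])‖) {lam : K}
    (hroot : ∀ n : ℕ, 1 ≤ n → lam ^ n ≠ 1) (hlam1 : 1 / (p : ℝ) < ‖1 - lam‖)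
    (hlam2 : ‖1 - lam‖ < 1) {b : ℕ → K} (hb : IsConjugacy lam (quadCoeff lam) b) {V n : ℕ}
    (hnV : n < p ^ (V + 1)) :
    Real.log ‖b (n + 1)‖ = -((n - (n / p : ℕ)) * Real.log ‖1 - lam‖ +
      ∑ v ∈ Finset.range V, ((n / p ^ (v + 1) : ℕ) : ℝ) *
        (Real.log ‖1 - lam ^ p ^ (v + 1)‖ - Real.log ‖1 - lam ^ p ^ v‖)) := by
  have hμ : 0 < ‖1 - lam‖ := lt_of_le_of_lt (by positivity) hlam1
  induction n with
  | zero => simp [hb.2.1]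
  | succ n ih =>
    have hstep := norm_conjugacy_succ hp3 hnat hroot hlam1 hlam2 hb (n + 1)
    have hA : 0 < ‖1 - lam ^ (n + 1)‖ :=
      norm_pos_iff.2 (sub_ne_zero.2 (hroot (n + 1) (by omega)).symm)
    have hb0 : 0 < ‖b (n + 1)‖ :=
      (norm_nonneg _).trans_lt (norm_conjugacy_succ hp3 hnat hroot hlam1 hlam2 hb n).1
    have hb1 := hb0.trans hstep.1
    have hlog := congrArg Real.log hstep.2
    rw [Real.log_mul hb1.ne' hA.ne', Real.log_mul hb0.ne' (by split_ifs <;> positivity),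
      ih (by omega), log_norm_one_sub_pow hnat hlam2 (by omega) hnV] at hlog
    have hsum : ∑ v ∈ Finset.range V, (((n + 1) / p ^ (v + 1) : ℕ) : ℝ) *
        (Real.log ‖1 - lam ^ p ^ (v + 1)‖ - Real.log ‖1 - lam ^ p ^ v‖) =
        ∑ v ∈ Finset.range V, ((n / p ^ (v + 1) : ℕ) : ℝ) *
          (Real.log ‖1 - lam ^ p ^ (v + 1)‖ - Real.log ‖1 - lam ^ p ^ v‖) +
        ∑ v ∈ Finset.range V, if p ^ (v + 1) ∣ n + 1 then
          Real.log ‖1 - lam ^ p ^ (v + 1)‖ - Real.log ‖1 - lam ^ p ^ v‖ else 0 := by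
      rw [← Finset.sum_add_distrib]
      refine Finset.sum_congr rfl fun v _ => ?_
      rw [Nat.succ_div]
      split_ifs <;> push_cast <;> ring
    have hdiv : (((n + 1) / p : ℕ) : ℝ) * Real.log ‖1 - lam‖ =
        ((n / p : ℕ) : ℝ) * Real.log ‖1 - lam‖ +
          Real.log (if p ∣ n + 1 then ‖1 - lam‖ else 1) := by
      rw [Nat.succ_div]
      split_ifs
      · push_cast
        ring
      · simp
    rw [hsum]
    push_cast at hdiv ⊢
    linarith

end Coefficients

/-! ### The radius -/

section Radius

/-- Summation by parts for the logarithm of the radius. -/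
lemma radius_sum_formula {q M e lp : ℝ} (hq : 1 < q) {L : ℕ → ℝ} {s t : ℕ} (hts : t ≤ s)
    (hL0 : L 0 = M) (hL1 : ∀ v < s, L v = q ^ v * M)
    (hL2 : ∀ j : ℕ, L (s + j) = q ^ t * e - ((s : ℝ) - t + j) * lp) {V : ℕ} (hV : s ≤ V) :
    (1 - 1 / q) * M + ∑ v ∈ Finset.range V, (L (v + 1) - L v) / q ^ (v + 1)
        - lp / (q ^ V * (q - 1)) =
      -1 / q * M - lp / (q ^ s * (q - 1)) - ((s : ℝ) - t) / q ^ s * lp +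
        s * (q - 1) / q * M + q ^ t / q ^ s * e := by
  have hq0 : q ≠ 0 := by positivity
  have hq1 : q - 1 ≠ 0 := by linarith
  induction V, hV using Nat.le_induction with
  | base =>
    rcases s with _ | s
    · obtain rfl : t = 0 := by omega
      have := hL2 0
      simp only [Nat.cast_zero, add_zero, pow_zero, one_mul, sub_zero, zero_mul] at this
      rw [hL0] at this
      simp [this]
      ring
    · rw [Finset.sum_range_succ]
      have h1 : ∑ v ∈ Finset.range s, (L (v + 1) - L v) / q ^ (v + 1) =
          s * ((1 - 1 / q) * M) := by
        rw [Finset.sum_congr rfl (g := fun _ => (1 - 1 / q) * M), Finset.sum_const,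
          Finset.card_range, nsmul_eq_mul]
        intro v hv
        rw [Finset.mem_range] at hv
        rw [hL1 (v + 1) (by omega), hL1 v (by omega)]
        field_simp
        ring
      have h2 := hL2 0
      rw [add_zero] at h2
      rw [h1, h2, hL1 s (by omega)]
      push_cast
      field_simp
      ring
  | succ V hV ih =>
    rw [← ih, Finset.sum_range_succ]
    obtain ⟨j, rfl⟩ := Nat.exists_eq_add_of_le hV
    have h1 := hL2 (j + 1)
    rw [← add_assoc] at h1
    rw [h1, hL2 j]
    push_cast
    field_simp
    ring

variable {p : ℕ} [Fact p.Prime] {K : Type*} [NontriviallyNormedField K]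

lemma rQuad_pos {lam γ₀ : K} (h0 : 0 < ‖1 - lam‖) (hε : 0 < ‖γ₀ - lam‖) (s t : ℕ) :
    0 < rQuad p lam γ₀ 1 s t := by
  have hp : p.Prime := Fact.out
  have hR := Rr_succ_pos hp.two_le s
  have hp0 : (0 : ℝ) < p := by exact_mod_cast hp.pos
  simp only [rQuad, rTilde, pow_one]
  positivity

lemma log_rQuad {lam γ₀ : K} (h0 : 0 < ‖1 - lam‖) (hε : 0 < ‖γ₀ - lam‖) (s t : ℕ) :
    Real.log (rQuad p lam γ₀ 1 s t) =
      -1 / p * Real.log ‖1 - lam‖ - Real.log p / ((p : ℝ) ^ s * (p - 1)) -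
        ((s : ℝ) - t) / (p : ℝ) ^ s * Real.log p +
        s * ((p : ℝ) - 1) / p * Real.log ‖1 - lam‖ +
        (p : ℝ) ^ t / (p : ℝ) ^ s * Real.log ‖γ₀ - lam‖ := by
  have hp : p.Prime := Fact.out
  have hp0 : (0 : ℝ) < p := by exact_mod_cast hp.pos
  have hR := Rr_succ_pos hp.two_le s
  simp only [rQuad, rTilde, pow_one, Nat.cast_one, one_mul, div_one, Real.rpow_one]
  rw [Real.log_mul (by positivity) (by positivity), Real.log_mul (by positivity) (by positivity),
    Real.log_mul (by positivity) (by positivity), Real.log_mul (by positivity) (by positivity),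
    Real.log_rpow h0, Real.log_rpow hp0, Real.log_rpow h0, Real.log_rpow hε, Rr_succ,
    Real.log_rpow hp0, Real.rpow_sub hp0, Real.rpow_natCast, Real.rpow_natCast, one_div_div]
  ring

variable [IsUltrametricDist K] [IsAlgClosed K]

lemma log_rQuad_eq_sum (hnat : ∀ n : ℕ, ‖(n : K)‖ = ‖(n : ℚ_[p])‖) {lam γ₀ : K} {s t : ℕ}
    (h0 : 0 < ‖1 - lam‖) (hε : 0 < ‖γ₀ - lam‖)
    (hs : Rr p s ≤ ‖1 - lam‖ ∧ ‖1 - lam‖ < Rr p (s + 1)) (hγ₀ : γ₀ ∈ GammaR p K)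
    (hγmin : ∀ γ ∈ GammaR p K, ‖γ₀ - lam‖ ≤ ‖γ - lam‖)
    (ht : Rr p t ≤ ‖γ₀ - lam‖ ∧ ‖γ₀ - lam‖ < Rr p (t + 1)) {V : ℕ} (hV : s ≤ V) :
    Real.log (rQuad p lam γ₀ 1 s t) = (1 - 1 / (p : ℝ)) * Real.log ‖1 - lam‖ +
      ∑ v ∈ Finset.range V, (Real.log ‖1 - lam ^ p ^ (v + 1)‖ - Real.log ‖1 - lam ^ p ^ v‖) /
        (p : ℝ) ^ (v + 1) - Real.log p / ((p : ℝ) ^ V * (p - 1)) := by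
  have hp : p.Prime := Fact.out
  have hp0 : (0 : ℝ) < p := by exact_mod_cast hp.pos
  obtain ⟨hts, h1, h2⟩ := norm_one_sub_pow_prime_pow hnat hs hγ₀ hγmin ht
  rw [log_rQuad h0 hε, radius_sum_formula (q := p) (e := Real.log ‖γ₀ - lam‖)
    (L := fun v => Real.log ‖1 - lam ^ p ^ v‖) (by exact_mod_cast hp.one_lt) hts (by simp)
    (fun v hv => ?_) (fun j => ?_) hV]
  · rw [h1 v hv, Real.log_pow]
    push_cast
    rfl
  · rw [h2 j, Real.log_mul (by positivity) (by positivity), Real.log_pow, Real.log_pow,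
      Real.log_inv]
    push_cast [Nat.cast_sub hts]
    ring

/-- The logarithm of `|b_{n+1}| r^n`, up to the tail of the series. -/
lemma log_norm_conjugacy_mul_pow (hp3 : 3 ≤ p) (hnat : ∀ n : ℕ, ‖(n : K)‖ = ‖(n : ℚ_[p])‖)
    {lam γ₀ : K} {s t : ℕ} (hroot : ∀ n : ℕ, 1 ≤ n → lam ^ n ≠ 1)
    (hlam1 : 1 / (p : ℝ) < ‖1 - lam‖) (hlam2 : ‖1 - lam‖ < 1) (hε : 0 < ‖γ₀ - lam‖)
    (hs : Rr p s ≤ ‖1 - lam‖ ∧ ‖1 - lam‖ < Rr p (s + 1)) (hγ₀ : γ₀ ∈ GammaR p K)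
    (hγmin : ∀ γ ∈ GammaR p K, ‖γ₀ - lam‖ ≤ ‖γ - lam‖)
    (ht : Rr p t ≤ ‖γ₀ - lam‖ ∧ ‖γ₀ - lam‖ < Rr p (t + 1)) {b : ℕ → K}
    (hb : IsConjugacy lam (quadCoeff lam) b) {V n : ℕ} (hV : s ≤ V + 1)
    (hnV : n < p ^ (V + 2)) :
    Real.log (‖b (n + 1)‖ * rQuad p lam γ₀ 1 s t ^ n) =
      ((n : ℝ) / p - (n / p : ℕ)) *
        (Real.log ‖1 - lam ^ p‖ - 2 * Real.log ‖1 - lam‖) +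
      ∑ v ∈ Finset.range V, ((n : ℝ) / (p : ℝ) ^ (v + 2) - (n / p ^ (v + 2) : ℕ)) *
        (Real.log ‖1 - lam ^ p ^ (v + 2)‖ - Real.log ‖1 - lam ^ p ^ (v + 1)‖) -
      n * (Real.log p / ((p : ℝ) ^ (V + 1) * (p - 1))) := by
  have hμ : 0 < ‖1 - lam‖ := lt_of_le_of_lt (by positivity) hlam1
  have hr := rQuad_pos (p := p) hμ hε s t
  have hb1 : 0 < ‖b (n + 1)‖ :=
    (norm_nonneg _).trans_lt (norm_conjugacy_succ hp3 hnat hroot hlam1 hlam2 hb n).1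
  rw [Real.log_mul hb1.ne' (by positivity), Real.log_pow,
    log_norm_conjugacy hp3 hnat hroot hlam1 hlam2 hb hnV,
    log_rQuad_eq_sum hnat hμ hε hs hγ₀ hγmin ht hV, Finset.sum_range_succ',
    Finset.sum_range_succ']
  simp only [zero_add, pow_one, pow_zero, add_assoc, Nat.reduceAdd, sub_mul, Finset.sum_sub_distrib]
  have hsum : (n : ℝ) * ∑ v ∈ Finset.range V,
      (Real.log ‖1 - lam ^ p ^ (v + 2)‖ - Real.log ‖1 - lam ^ p ^ (v + 1)‖) / (p : ℝ) ^ (v + 2) =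
      ∑ v ∈ Finset.range V, (n : ℝ) / (p : ℝ) ^ (v + 2) *
        (Real.log ‖1 - lam ^ p ^ (v + 2)‖ - Real.log ‖1 - lam ^ p ^ (v + 1)‖) := by
    rw [Finset.mul_sum]
    exact Finset.sum_congr rfl fun v _ => by ring
  rw [← hsum]
  ring

lemma norm_conjugacy_mul_pow_le_one (hp3 : 3 ≤ p)
    (hnat : ∀ n : ℕ, ‖(n : K)‖ = ‖(n : ℚ_[p])‖)
    {lam γ₀ : K} {s t : ℕ} (hroot : ∀ n : ℕ, 1 ≤ n → lam ^ n ≠ 1)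
    (hlam1 : 1 / (p : ℝ) < ‖1 - lam‖) (hlam2 : ‖1 - lam‖ < 1) (hε : 0 < ‖γ₀ - lam‖)
    (hs : Rr p s ≤ ‖1 - lam‖ ∧ ‖1 - lam‖ < Rr p (s + 1)) (hγ₀ : γ₀ ∈ GammaR p K)
    (hγmin : ∀ γ ∈ GammaR p K, ‖γ₀ - lam‖ ≤ ‖γ - lam‖)
    (ht : Rr p t ≤ ‖γ₀ - lam‖ ∧ ‖γ₀ - lam‖ < Rr p (t + 1)) {b : ℕ → K}
    (hb : IsConjugacy lam (quadCoeff lam) b) (n : ℕ) :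
    ‖b (n + 1)‖ * rQuad p lam γ₀ 1 s t ^ n ≤ 1 := by
  have hp : p.Prime := Fact.out
  have hp1 : (1 : ℝ) < p := by exact_mod_cast hp.one_lt
  have hμ : 0 < ‖1 - lam‖ := lt_of_le_of_lt (by positivity) hlam1
  have hlam := norm_eq_one_of_norm_one_sub_lt_one hlam2
  have hr := rQuad_pos (p := p) hμ hε s t
  have hpos : ∀ k, 1 ≤ k → 0 < ‖1 - lam ^ k‖ := fun k hk =>
    norm_pos_iff.2 (sub_ne_zero.2 (hroot k hk).symm)
  have hfrac : ∀ k : ℕ, 0 ≤ (n : ℝ) / (p : ℝ) ^ k - (n / p ^ k : ℕ) := fun k => by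
    have := Nat.cast_div_le (α := ℝ) (m := n) (n := p ^ k)
    push_cast at this
    linarith
  rw [← Real.log_nonpos_iff (by positivity), log_norm_conjugacy_mul_pow hp3 hnat hroot hlam1 hlam2
    hε hs hγ₀ hγmin ht hb (V := s + n) (by omega)
    ((Nat.lt_pow_self hp.one_lt).trans (Nat.pow_lt_pow_right hp.one_lt (by omega)))]
  have hA : ((n : ℝ) / p - (n / p : ℕ)) *
      (Real.log ‖1 - lam ^ p‖ - 2 * Real.log ‖1 - lam‖) ≤ 0 := by
    refine mul_nonpos_of_nonneg_of_nonpos (by simpa using hfrac 1) ?_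
    have hle : ‖1 - lam ^ p‖ ≤ ‖1 - lam‖ ^ 2 := by
      refine (norm_one_sub_pow_prime_le hnat hlam.le).trans (max_le ?_ ?_)
      · exact pow_le_pow_of_le_one hμ.le hlam2.le hp.two_le
      · rw [sq, ← one_div]
        exact mul_le_mul_of_nonneg_right hlam1.le hμ.le
    have := Real.log_le_log (hpos p hp.one_le) hle
    rw [Real.log_pow] at this
    push_cast at this
    linarith
  have hB : ∑ v ∈ Finset.range (s + n), ((n : ℝ) / (p : ℝ) ^ (v + 2) - (n / p ^ (v + 2) : ℕ)) *
      (Real.log ‖1 - lam ^ p ^ (v + 2)‖ - Real.log ‖1 - lam ^ p ^ (v + 1)‖) ≤ 0 := by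
    refine Finset.sum_nonpos fun v _ => mul_nonpos_of_nonneg_of_nonpos (hfrac _) ?_
    rw [sub_nonpos]
    refine Real.log_le_log (hpos _ (Nat.one_le_pow _ _ hp.pos)) ?_
    rw [show v + 2 = (v + 1) + 1 by omega, pow_succ p (v + 1), pow_mul]
    exact norm_one_sub_pow_le (by simp [hlam]) p
  have hC : 0 ≤ (n : ℝ) * (Real.log p / ((p : ℝ) ^ (s + n + 1) * (p - 1))) := by
    have := Real.log_pos hp1
    have : (0 : ℝ) < (p : ℝ) - 1 := by linarith
    positivity
  linarith

lemma inv_le_norm_conjugacy_mul_pow (hp3 : 3 ≤ p)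
    (hnat : ∀ n : ℕ, ‖(n : K)‖ = ‖(n : ℚ_[p])‖)
    {lam γ₀ : K} {s t : ℕ} (hroot : ∀ n : ℕ, 1 ≤ n → lam ^ n ≠ 1)
    (hlam1 : 1 / (p : ℝ) < ‖1 - lam‖) (hlam2 : ‖1 - lam‖ < 1) (hε : 0 < ‖γ₀ - lam‖)
    (hs : Rr p s ≤ ‖1 - lam‖ ∧ ‖1 - lam‖ < Rr p (s + 1)) (hγ₀ : γ₀ ∈ GammaR p K)
    (hγmin : ∀ γ ∈ GammaR p K, ‖γ₀ - lam‖ ≤ ‖γ - lam‖)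
    (ht : Rr p t ≤ ‖γ₀ - lam‖ ∧ ‖γ₀ - lam‖ < Rr p (t + 1)) {b : ℕ → K}
    (hb : IsConjugacy lam (quadCoeff lam) b) {V : ℕ} (hV : s ≤ V + 1) :
    (p : ℝ)⁻¹ ≤ ‖b (p ^ (V + 1) + 1)‖ * rQuad p lam γ₀ 1 s t ^ p ^ (V + 1) := by
  have hp : p.Prime := Fact.out
  have hp2 : (2 : ℝ) ≤ p := by exact_mod_cast hp.two_le
  have hμ : 0 < ‖1 - lam‖ := lt_of_le_of_lt (by positivity) hlam1
  have hr := rQuad_pos (p := p) hμ hε s t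
  have hb1 : 0 < ‖b (p ^ (V + 1) + 1)‖ :=
    (norm_nonneg _).trans_lt (norm_conjugacy_succ hp3 hnat hroot hlam1 hlam2 hb _).1
  have hfrac : ∀ k ≤ V + 1, ((p ^ (V + 1) : ℕ) : ℝ) / (p : ℝ) ^ k -
      (p ^ (V + 1) / p ^ k : ℕ) = 0 := fun k hk => by
    rw [Nat.cast_div (pow_dvd_pow p hk) (by positivity)]
    push_cast
    ring
  rw [← Real.log_le_log_iff (by positivity) (by positivity), log_norm_conjugacy_mul_pow hp3 hnat
    hroot hlam1 hlam2 hε hs hγ₀ hγmin ht hb hV (Nat.pow_lt_pow_right hp.one_lt (by omega))]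
  have h1 := hfrac 1 (by omega)
  rw [pow_one, pow_one] at h1
  rw [h1, Finset.sum_eq_zero fun v hv => by
    rw [hfrac (v + 2) (by have := Finset.mem_range.1 hv; omega), zero_mul], Real.log_inv]
  have h2 : ((p ^ (V + 1) : ℕ) : ℝ) * (Real.log p / ((p : ℝ) ^ (V + 1) * (p - 1))) =
      Real.log p / (p - 1) := by
    have : (p : ℝ) - 1 ≠ 0 := by linarith
    push_cast
    field_simp
  rw [h2]
  have h3 : Real.log p / ((p : ℝ) - 1) ≤ Real.log p :=
    div_le_self (Real.log_nonneg (by linarith)) (by linarith)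
  linarith

end Radius

/-! ### Evaluation of the conjugacy -/

section Evaluation

variable {K : Type*}

lemma sum_coeff_mk_quadCoeff_pow_mul [Field K] (lam x : K) (l : ℕ) :
    ∑ k ∈ Finset.range (2 * l + 1),
      PowerSeries.coeff k ((PowerSeries.mk (quadCoeff lam)) ^ l) * x ^ k =
        (lam * x + x ^ 2) ^ l := by
  have h : PowerSeries.mk (quadCoeff lam) =
      ((Polynomial.C lam * Polynomial.X + Polynomial.X ^ 2 : Polynomial K) : PowerSeries K) := by
    ext n
    rcases n with _ | _ | _ | n <;> simp [quadCoeff, PowerSeries.coeff_X_pow]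
  have hdeg : (Polynomial.C lam * Polynomial.X + Polynomial.X ^ 2 : Polynomial K).natDegree ≤ 2 := by
    compute_degree
  have hdeg' : ((Polynomial.C lam * Polynomial.X + Polynomial.X ^ 2 : Polynomial K) ^ l).natDegree
      < 2 * l + 1 := by
    have := Polynomial.natDegree_pow_le_of_le l hdeg
    omega
  have := Polynomial.eval_eq_sum_range' hdeg' x
  simp only [Polynomial.eval_pow, Polynomial.eval_add, Polynomial.eval_mul, Polynomial.eval_C,
    Polynomial.eval_X] at this
  rw [this, h]
  simp only [← Polynomial.coe_pow, Polynomial.coeff_coe]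

lemma coeff_mk_quadCoeff_pow_eq_zero [Field K] (lam : K) {l k : ℕ} (h : k < l ∨ 2 * l < k) :
    PowerSeries.coeff k ((PowerSeries.mk (quadCoeff lam)) ^ l) = 0 := by
  rw [coeff_mk_quadCoeff_pow]
  split_ifs with hlk
  · rw [Nat.choose_eq_zero_of_lt (by omega), Nat.cast_zero, mul_zero]
  · rfl

variable [NontriviallyNormedField K] {b : ℕ → K} {r : ℝ}

lemma pEval_zero (hb0 : b 0 = 0) : pEval b 0 = 0 := by
  rw [pEval]
  convert tsum_zero with k
  rcases k with _ | k <;> simp [hb0]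

/-- A power series that vanishes near `0` has zero coefficients. -/
lemma coeff_eq_zero_of_hasSum_zero {e : ℕ → K} {δ : ℝ} (hδ : 0 < δ)
    (h : ∀ x : K, ‖x‖ < δ → HasSum (fun k => e k * x ^ k) 0) (k : ℕ) : e k = 0 := by
  have hfps : HasFPowerSeriesAt (0 : K → K) (FormalMultilinearSeries.ofScalars K e) 0 := by
    rw [hasFPowerSeriesAt_iff]
    filter_upwards [Metric.ball_mem_nhds (0 : K) hδ] with z hz
    simpa [FormalMultilinearSeries.coeff_ofScalars, mul_comm] using
      h z (by simpa using hz)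
  have := congrArg (fun q => FormalMultilinearSeries.coeff q k) hfps.eq_zero
  rw [FormalMultilinearSeries.coeff_ofScalars] at this
  exact this

variable [IsUltrametricDist K]

lemma norm_pow_sub_pow_le {x y : K} {ρ : ℝ} (hx : ‖x‖ ≤ ρ) (hy : ‖y‖ ≤ ρ) (n : ℕ) :
    ‖x ^ (n + 1) - y ^ (n + 1)‖ ≤ ρ ^ n * ‖x - y‖ := by
  have hρ : 0 ≤ ρ := (norm_nonneg _).trans hx
  rw [← geom_sum₂_mul, norm_mul]
  gcongr
  refine IsUltrametricDist.norm_sum_le_of_forall_le_of_nonneg (by positivity) fun i hi => ?_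
  rw [Finset.mem_range] at hi
  rw [norm_mul, norm_pow, norm_pow]
  calc ‖x‖ ^ i * ‖y‖ ^ (n + 1 - 1 - i) ≤ ρ ^ i * ρ ^ (n + 1 - 1 - i) := by gcongr
    _ = ρ ^ n := by rw [← pow_add]; congr 1; omega

variable [CompleteSpace K]

/-- Substituting `λ x + x ^ 2` into a power series with geometrically bounded coefficients. -/
lemma hasSum_compCoeff_mul_pow {lam : K} (hlam : ‖lam‖ ≤ 1) {C σ : ℝ}
    (hσ : 0 < σ) (hbound : ∀ l, ‖b l‖ * σ ^ l ≤ C) {x : K} (hx : ‖x‖ < σ) (hx1 : ‖x‖ ≤ 1) :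
    HasSum (fun k => compCoeff b (quadCoeff lam) k * x ^ k) (pEval b (lam * x + x ^ 2)) := by
  set f : ℕ × ℕ → K := fun q =>
    b q.1 * PowerSeries.coeff q.2 ((PowerSeries.mk (quadCoeff lam)) ^ q.1) * x ^ q.2 with hf
  have hC : 0 ≤ C := (by positivity : (0 : ℝ) ≤ ‖b 0‖ * σ ^ 0).trans (hbound 0)
  set θ := ‖x‖ / σ with hθ
  have hθ0 : 0 ≤ θ := by positivity
  have hθ1 : θ < 1 := (div_lt_one hσ).2 hx
  set τ := √(√θ) with hτ
  have hτ0 : 0 ≤ τ := Real.sqrt_nonneg _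
  have hτ1 : τ < 1 := by
    rw [hτ, Real.sqrt_lt' one_pos, one_pow, Real.sqrt_lt' one_pos, one_pow]
    exact hθ1
  have hτ4 : τ ^ 4 = θ := by
    rw [show 4 = 2 * 2 from rfl, pow_mul, Real.sq_sqrt (Real.sqrt_nonneg _), Real.sq_sqrt hθ0]
  have hfbound : ∀ q, ‖f q‖ ≤ C * (τ ^ q.1 * τ ^ q.2) := by
    rintro ⟨l, k⟩
    by_cases hlk : k < l ∨ 2 * l < k
    · simp only [hf, coeff_mk_quadCoeff_pow_eq_zero lam hlk, mul_zero, zero_mul, norm_zero]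
      positivity
    · push Not at hlk
      calc ‖f (l, k)‖ = ‖b l‖ * ‖PowerSeries.coeff k ((PowerSeries.mk (quadCoeff lam)) ^ l)‖ *
            ‖x‖ ^ k := by simp only [hf, norm_mul, norm_pow]
        _ ≤ ‖b l‖ * 1 * ‖x‖ ^ l := by
          gcongr ‖b l‖ * ?_ * ?_
          · exact norm_coeff_mk_quadCoeff_pow_le hlam _ _
          · exact pow_le_pow_of_le_one (norm_nonneg _) hx1 hlk.1
        _ = ‖b l‖ * σ ^ l * θ ^ l := by
          rw [hθ, div_pow]
          field_simp
        _ ≤ C * θ ^ l := by gcongr; exact hbound l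
        _ = C * τ ^ (4 * l) := by rw [pow_mul, hτ4]
        _ ≤ C * τ ^ (l + k) := by
          gcongr C * ?_
          exact pow_le_pow_of_le_one hτ0 hτ1.le (by omega)
        _ = C * (τ ^ l * τ ^ k) := by rw [pow_add]
  have hgeom := summable_geometric_of_lt_one hτ0 hτ1
  have hsum : Summable f := by
    refine Summable.of_norm_bounded ?_ hfbound
    exact (hgeom.mul_of_nonneg hgeom (fun _ => by positivity) fun _ => by positivity).mul_left C
  have hrow : ∀ l, HasSum (fun k => f (l, k)) (b l * (lam * x + x ^ 2) ^ l) := fun l => by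
    rw [← sum_coeff_mk_quadCoeff_pow_mul, Finset.mul_sum]
    simp only [← mul_assoc]
    refine hasSum_sum_of_ne_finset_zero fun k hk => ?_
    rw [Finset.mem_range, not_lt] at hk
    simp only [hf, coeff_mk_quadCoeff_pow_eq_zero lam (l := l) (k := k) (by omega), mul_zero,
      zero_mul]
  have hcol : ∀ k, HasSum (fun l => f (l, k)) (compCoeff b (quadCoeff lam) k * x ^ k) :=
    fun k => by
      rw [compCoeff, Finset.sum_mul]
      refine hasSum_sum_of_ne_finset_zero fun l hl => ?_
      rw [Finset.mem_range, not_lt] at hl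
      simp only [hf, coeff_mk_quadCoeff_pow_eq_zero lam (l := l) (k := k) (by omega), mul_zero,
        zero_mul]
  have h1 := hsum.hasSum.prod_fiberwise hrow
  have h2 := ((Equiv.prodComm ℕ ℕ).hasSum_iff.2 hsum.hasSum).prod_fiberwise hcol
  rw [pEval, h1.tsum_eq]
  exact h2

lemma summable_mul_pow_of_lt (hr : 0 < r) (hb : ∀ n, ‖b (n + 1)‖ * r ^ n ≤ 1)
    {x : K} (hx : ‖x‖ < r) : Summable fun k => b k * x ^ k := by
  refine (summable_nat_add_iff 1).1 ?_
  refine Summable.of_norm_bounded (g := fun n => ‖x‖ * (‖x‖ / r) ^ n)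
    ((summable_geometric_of_lt_one (by positivity) ((div_lt_one hr).2 hx)).mul_left _) fun n => ?_
  rw [norm_mul, norm_pow]
  calc ‖b (n + 1)‖ * ‖x‖ ^ (n + 1) = (‖b (n + 1)‖ * r ^ n) * (‖x‖ * (‖x‖ / r) ^ n) := by
        rw [div_pow]
        field_simp
        ring
    _ ≤ 1 * (‖x‖ * (‖x‖ / r) ^ n) := by gcongr; exact hb n
    _ = _ := one_mul _

/-- A normalized power series is a small perturbation of the identity inside its disk. -/
lemma norm_pEval_sub_sub_le (hr : 0 < r) (hb0 : b 0 = 0) (hb1 : b 1 = 1)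
    (hb : ∀ n, ‖b (n + 1)‖ * r ^ n ≤ 1) {x y : K} {ρ : ℝ} (hρ : ρ < r) (hx : ‖x‖ ≤ ρ)
    (hy : ‖y‖ ≤ ρ) : ‖(pEval b x - x) - (pEval b y - y)‖ ≤ ρ / r * ‖x - y‖ := by
  have hρ0 : 0 ≤ ρ := (norm_nonneg _).trans hx
  have hs : ∀ z : K, ‖z‖ ≤ ρ →
      HasSum (fun k => b k * z ^ k - if k = 1 then z else 0) (pEval b z - z) := fun z hz =>
    (summable_mul_pow_of_lt hr hb (hz.trans_lt hρ)).hasSum.sub (hasSum_ite_eq 1 z)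
  have := (hs x hx).sub (hs y hy)
  rw [← this.tsum_eq]
  refine IsUltrametricDist.norm_tsum_le_of_forall_le_of_nonneg (by positivity) fun k => ?_
  rcases k with _ | _ | n
  · simp only [hb0, zero_mul, zero_ne_one, if_false, sub_self, norm_zero]
    positivity
  · simp only [hb1, zero_add, pow_one, one_mul, if_true, sub_self, norm_zero]
    positivity
  · have hn : ¬ n + 1 + 1 = 1 := by omega
    simp only [hn, if_false, sub_zero]
    rw [← mul_sub, norm_mul]
    have hq : ρ / r ≤ 1 := (div_le_one hr).2 hρ.le
    calc ‖b (n + 1 + 1)‖ * ‖x ^ (n + 1 + 1) - y ^ (n + 1 + 1)‖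
        ≤ ‖b (n + 1 + 1)‖ * (ρ ^ (n + 1) * ‖x - y‖) := by
          gcongr
          exact norm_pow_sub_pow_le hx hy (n + 1)
      _ = (‖b (n + 1 + 1)‖ * r ^ (n + 1)) * ((ρ / r) ^ (n + 1) * ‖x - y‖) := by
          rw [div_pow]
          field_simp
      _ ≤ 1 * ((ρ / r) ^ 1 * ‖x - y‖) := by
          gcongr ?_ * (?_ * _)
          · exact hb (n + 1)
          · exact pow_le_pow_of_le_one (by positivity) hq (by omega)
      _ = ρ / r * ‖x - y‖ := by rw [one_mul, pow_one]

lemma bijOn_pEval_ball (hr : 0 < r) (hb0 : b 0 = 0) (hb1 : b 1 = 1)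
    (hb : ∀ n, ‖b (n + 1)‖ * r ^ n ≤ 1) :
    Set.BijOn (pEval b) (Metric.ball 0 r) (Metric.ball 0 r) := by
  have hnear : ∀ {x : K} {ρ : ℝ}, ρ < r → ‖x‖ ≤ ρ → ‖pEval b x - x‖ ≤ ρ / r * ‖x‖ := by
    intro x ρ hρ hx
    have := norm_pEval_sub_sub_le hr hb0 hb1 hb hρ hx
      (y := 0) (by simpa using (norm_nonneg x).trans hx)
    simpa [pEval_zero hb0] using this
  refine ⟨fun x hx => ?_, fun x hx y hy hxy => ?_, fun w hw => ?_⟩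
  · rw [mem_ball_zero_iff] at hx ⊢
    have h1 := hnear hx le_rfl
    have h2 := IsUltrametricDist.norm_add_le_max (pEval b x - x) x
    rw [sub_add_cancel] at h2
    refine h2.trans_lt (max_lt (h1.trans_lt ?_) hx)
    exact (mul_le_of_le_one_left (norm_nonneg _) ((div_le_one hr).2 hx.le)).trans_lt hx
  · rw [mem_ball_zero_iff] at hx hy
    by_contra hne
    have hpos : 0 < ‖x - y‖ := norm_pos_iff.2 (sub_ne_zero.2 hne)
    have h := norm_pEval_sub_sub_le hr hb0 hb1 hb (max_lt hx hy) (le_max_left _ _)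
      (le_max_right _ _)
    have hxy' : (pEval b x - x) - (pEval b y - y) = -(x - y) := by rw [hxy]; ring
    rw [hxy', norm_neg] at h
    exact absurd h (not_le.2 (mul_lt_of_lt_one_left hpos ((div_lt_one hr).2 (max_lt hx hy))))
  · rw [mem_ball_zero_iff] at hw
    set c : NNReal := ⟨‖w‖ / r, by positivity⟩ with hc
    have hc1 : c < 1 := by
      rw [← NNReal.coe_lt_coe]
      exact (div_lt_one hr).2 hw
    set g : K → K := fun x => w - (pEval b x - x) with hg
    have hmaps : Set.MapsTo g (Metric.closedBall 0 ‖w‖) (Metric.closedBall 0 ‖w‖) := by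
      intro x hx
      rw [mem_closedBall_zero_iff] at hx ⊢
      have h2 := IsUltrametricDist.norm_add_le_max w (-(pEval b x - x))
      rw [← sub_eq_add_neg, norm_neg] at h2
      refine h2.trans (max_le le_rfl ((hnear hw hx).trans ?_))
      exact (mul_le_of_le_one_left (norm_nonneg _) ((div_le_one hr).2 hw.le)).trans hx
    have hcontr : ContractingWith c (hmaps.restrict g _ _) := by
      refine ⟨hc1, LipschitzWith.of_dist_le_mul fun x y => ?_⟩
      have hx := mem_closedBall_zero_iff.1 x.2
      have hy := mem_closedBall_zero_iff.1 y.2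
      have h := norm_pEval_sub_sub_le hr hb0 hb1 hb hw hx hy
      rw [Subtype.dist_eq, Subtype.dist_eq, dist_eq_norm, dist_eq_norm]
      have e : g x - g y = -((pEval b x - x) - (pEval b y - y)) := by simp only [hg]; ring
      rw [Set.MapsTo.val_restrict_apply, Set.MapsTo.val_restrict_apply, e, norm_neg]
      exact h
    obtain ⟨x, hx, hfix, -⟩ := hcontr.exists_fixedPoint' Metric.isClosed_closedBall.isComplete
      hmaps (Metric.mem_closedBall_self (norm_nonneg w)) (edist_ne_top _ _)
    rw [mem_closedBall_zero_iff] at hx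
    refine ⟨x, mem_ball_zero_iff.2 (hx.trans_lt hw), ?_⟩
    have : w - (pEval b x - x) = x := hfix
    linear_combination -this

/-- The coefficients of a normalized power series that converges at `x₀ ≠ 0` and linearizes
`λ x + x ^ 2` on the disk of radius `‖x₀‖` form a formal conjugacy. -/
lemma isConjugacy_of_conjugates {lam : K} (hlam : ‖lam‖ ≤ 1) (hb0 : b 0 = 0) (hb1 : b 1 = 1)
    {x₀ : K} (hx₀ : x₀ ≠ 0) (hsum : Summable fun k => b k * x₀ ^ k)
    (hconj : ∀ x : K, ‖x‖ < ‖x₀‖ → pEval b (lam * x + x ^ 2) = lam * pEval b x)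
    (hsumm : ∀ x : K, ‖x‖ < ‖x₀‖ → Summable fun k => b k * x ^ k) :
    IsConjugacy lam (quadCoeff lam) b := by
  have hσ : 0 < ‖x₀‖ := norm_pos_iff.2 hx₀
  obtain ⟨C, hC⟩ := (Metric.isBounded_range_of_tendsto _ hsum.tendsto_atTop_zero).exists_norm_le
  refine ⟨hb0, hb1, fun k => ?_⟩
  rw [← sub_eq_zero]
  refine coeff_eq_zero_of_hasSum_zero (e := fun k => compCoeff b (quadCoeff lam) k - lam * b k)
    (lt_min hσ one_pos) (fun x hx => ?_) k
  have hx' := lt_min_iff.1 hx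
  have h1 := hasSum_compCoeff_mul_pow hlam hσ (C := C)
    (fun l => by simpa using hC _ ⟨l, rfl⟩) hx'.1 hx'.2.le
  rw [hconj x hx'.1] at h1
  have h2 := (hsumm x hx'.1).hasSum.mul_left lam
  have h3 := h1.sub h2
  rw [pEval, sub_self] at h3
  simpa only [sub_mul, mul_assoc] using h3

end Evaluation

end QuadraticLinearization

open QuadraticLinearization in
/-- Theorem B: the exact size of quadratic linearization disks.
For `p ≥ 3` and `1/p < |1-λ| < 1`, the conjugacy of `P_λ(x) = λx + x²` converges on the
open disk of radius `r(P_λ) = |1-λ|^{-1/p}·r̃(λ)`, diverges on the sphere of that radius,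
is a bijection of the open disk onto itself conjugating `P_λ` to `x ↦ λx`; the linearization
disk of `P_λ` is exactly `D_{r(P_λ)}(0)`. -/
theorem stmt1 (p : ℕ) [Fact p.Prime] (hp3 : 3 ≤ p)
    {K : Type*} [NontriviallyNormedField K] [IsUltrametricDist K] [CompleteSpace K]
    [IsAlgClosed K] [Algebra ℚ_[p] K]
    (hiso : ∀ x : ℚ_[p], ‖algebraMap ℚ_[p] K x‖ = ‖x‖)
    (hdense : Dense {x : K | IsAlgebraic ℚ_[p] x})
    (lam : K) (hroot : ∀ n : ℕ, 1 ≤ n → lam ^ n ≠ 1)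
    (hlam1 : 1 / (p : ℝ) < ‖1 - lam‖) (hlam2 : ‖1 - lam‖ < 1)
    (m : ℕ) (hm : IsLeast {n : ℕ | 1 ≤ n ∧ ‖1 - lam ^ n‖ < 1} m)
    (s : ℕ) (hs : Rr p s ≤ ‖1 - lam ^ m‖ ∧ ‖1 - lam ^ m‖ < Rr p (s + 1))
    (γ₀ : K) (hγ₀ : γ₀ ∈ GammaR p K)
    (hγmin : ∀ γ ∈ GammaR p K, ‖γ₀ - lam ^ m‖ ≤ ‖γ - lam ^ m‖)
    (t : ℕ) (ht : Rr p t ≤ ‖γ₀ - lam ^ m‖ ∧ ‖γ₀ - lam ^ m‖ < Rr p (t + 1))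
    (b : ℕ → K) (hb : IsConjugacy lam (quadCoeff lam) b) :
    (∀ x : K, ‖x‖ < rQuad p lam γ₀ m s t → Summable fun k => b k * x ^ k) ∧
    (∀ x : K, ‖x‖ = rQuad p lam γ₀ m s t → ¬ Summable fun k => b k * x ^ k) ∧
    Set.BijOn (pEval b) (Metric.ball (0 : K) (rQuad p lam γ₀ m s t))
      (Metric.ball (0 : K) (rQuad p lam γ₀ m s t)) ∧
    (∀ x ∈ Metric.ball (0 : K) (rQuad p lam γ₀ m s t),
      pEval b (lam * x + x ^ 2) = lam * pEval b x) ∧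
    LinearizableOn (fun x : K => lam * x + x ^ 2) lam
      (Metric.ball (0 : K) (rQuad p lam γ₀ m s t)) ∧
    (∀ U : Set K, IsZeroDisk U → LinearizableOn (fun x : K => lam * x + x ^ 2) lam U →
      U ⊆ Metric.ball (0 : K) (rQuad p lam γ₀ m s t)) := by
  obtain rfl : m = 1 := hm.unique ⟨⟨le_rfl, by simpa using hlam2⟩, fun n hn => hn.1⟩
  simp only [pow_one] at hs hγmin ht
  have hp : p.Prime := Fact.out
  have hnat := norm_natCast_of_isometric (p := p) hiso
  have hμ : 0 < ‖1 - lam‖ := lt_of_le_of_lt (by positivity) hlam1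
  have hlam : ‖lam‖ = 1 := norm_eq_one_of_norm_one_sub_lt_one hlam2
  have hε : 0 < ‖γ₀ - lam‖ := by
    rw [norm_pos_iff, sub_ne_zero]
    rintro rfl
    obtain ⟨k, hk⟩ := hγ₀
    exact hroot _ (Nat.one_le_pow _ _ hp.pos) hk
  have hr := rQuad_pos (p := p) hμ hε s t
  have hupper := norm_conjugacy_mul_pow_le_one hp3 hnat hroot hlam1 hlam2 hε hs hγ₀ hγmin ht hb
  have hlower := fun V (hV : s ≤ V + 1) => inv_le_norm_conjugacy_mul_pow hp3 hnat hroot hlam1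
    hlam2 hε hs hγ₀ hγmin ht hb hV
  set r := rQuad p lam γ₀ 1 s t with hrdef
  have hr1 : r < 1 := by
    by_contra! h
    have h1 := (norm_conjugacy_succ hp3 hnat hroot hlam1 hlam2 hb 1).1
    rw [hb.2.1, norm_one] at h1
    have h2 := hupper 1
    rw [pow_one] at h2
    nlinarith
  have hdiv : ∀ x : K, r ≤ ‖x‖ → ¬ Summable fun k => b k * x ^ k := fun x hx hsum => by
    have htend := hsum.tendsto_atTop_zero.norm
    rw [norm_zero] at htend
    have hp0 : (0 : ℝ) < p := by exact_mod_cast hp.pos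
    obtain ⟨N, hN⟩ := Filter.eventually_atTop.1
      (htend.eventually_lt_const (show (0 : ℝ) < (p : ℝ)⁻¹ * r by positivity))
    have hlow := hlower (s + N) (by omega)
    have hbig : N ≤ p ^ (s + N + 1) + 1 := by
      have := Nat.lt_pow_self (n := s + N + 1) hp.one_lt
      omega
    refine absurd (hN _ hbig) (not_lt.2 ?_)
    rw [norm_mul, norm_pow]
    calc (p : ℝ)⁻¹ * r ≤ ‖b (p ^ (s + N + 1) + 1)‖ * r ^ p ^ (s + N + 1) * r := by gcongr
      _ = ‖b (p ^ (s + N + 1) + 1)‖ * r ^ (p ^ (s + N + 1) + 1) := by rw [pow_succ r, mul_assoc]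
      _ ≤ _ := by gcongr
  have hsumm : ∀ x : K, ‖x‖ < r → Summable fun k => b k * x ^ k := fun x hx =>
    summable_mul_pow_of_lt hr hupper hx
  have hbij := bijOn_pEval_ball hr hb.1 hb.2.1 hupper
  have hconj : ∀ x ∈ Metric.ball (0 : K) r, pEval b (lam * x + x ^ 2) = lam * pEval b x := by
    intro x hx
    rw [mem_ball_zero_iff] at hx
    have hbound : ∀ l, ‖b l‖ * r ^ l ≤ r := by
      rintro (_ | l)
      · simpa [hb.1] using hr.le
      · rw [pow_succ, ← mul_assoc]
        exact mul_le_of_le_one_left hr.le (hupper l)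
    have h1 := hasSum_compCoeff_mul_pow hlam.le hr hbound hx (hx.trans hr1).le
    have h2 := (hsumm x hx).hasSum.mul_left lam
    simp only [hb.2.2, mul_assoc] at h1
    exact h1.unique h2
  have hmaps : Set.MapsTo (fun x : K => lam * x + x ^ 2) (Metric.ball 0 r) (Metric.ball 0 r) := by
    intro x hx
    rw [mem_ball_zero_iff] at hx ⊢
    refine (IsUltrametricDist.norm_add_le_max _ _).trans_lt (max_lt ?_ ?_)
    · rwa [norm_mul, hlam, one_mul]
    · rw [norm_pow]
      exact (pow_le_of_le_one (norm_nonneg _) (hx.trans hr1).le two_ne_zero).trans_lt hx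
  refine ⟨hsumm, fun x hx => hdiv x hx.ge, hbij, hconj,
    ⟨hmaps, b, hb.1, hb.2.1, fun x hx => hsumm x (mem_ball_zero_iff.1 hx), hbij, hconj⟩, ?_⟩
  rintro U ⟨ρ, hU⟩ ⟨-, b', hb0, hb1, hsum', -, hconj'⟩ x hxU
  rw [mem_ball_zero_iff]
  by_contra! hx
  have hsub : ∀ y : K, ‖y‖ < ‖x‖ → y ∈ U := fun y hy => by
    rcases hU with rfl | rfl
    · rw [mem_ball_zero_iff] at hxU ⊢
      exact hy.trans hxU
    · rw [mem_closedBall_zero_iff] at hxU ⊢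
      exact hy.le.trans hxU
  have hx0 : x ≠ 0 := norm_pos_iff.1 (hr.trans_le hx)
  have hb' : IsConjugacy lam (quadCoeff lam) b' :=
    isConjugacy_of_conjugates hlam.le hb0 hb1 hx0 (hsum' x hxU) (fun y hy => hconj' y (hsub y hy))
      fun y hy => hsum' y (hsub y hy)
  have hlam0 : lam ≠ 0 := norm_pos_iff.1 (by rw [hlam]; exact one_pos)
  obtain rfl := conjugacy_unique hlam0 hroot hb hb'
  exact hdiv x hx (hsum' x hxU)
end

section
/- Let p ≥ 3 and let f(x) = λx + Σ_{i≥2} a_i x^i ∈ 𝒪_p[[x]] with λ not a root of unity, 1/p < |1-λ| < 1, |a₂| = 1 and |a₂² - a₃| = 1. Then the linearization disk of f is Δ_f = D_{r(f)}(0) with r(f) = |1-λ|^{-1/p} · r̃(λ); in particular Δ_f equals the linearization disk of the quadratic polynomial P_λ(x) = λx + x². -/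
open scoped BigOperators

section UltrametricField

variable {K : Type*} [NontriviallyNormedField K] [IsUltrametricDist K]

theorem norm_add_eq_left_of_norm_lt {x y : K} (h : ‖y‖ < ‖x‖) : ‖x + y‖ = ‖x‖ := by
  rw [IsUltrametricDist.norm_add_eq_max_of_norm_ne_norm h.ne', max_eq_left h.le]

theorem norm_eq_of_norm_sub_lt {x y : K} (h : ‖x - y‖ < ‖y‖) : ‖x‖ = ‖y‖ := by
  simpa using norm_add_eq_left_of_norm_lt h

theorem norm_sub_le_max' (x y : K) : ‖x - y‖ ≤ max ‖x‖ ‖y‖ := by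
  simpa [sub_eq_add_neg] using IsUltrametricDist.norm_add_le_max x (-y)

theorem norm_sub_eq_right_of_norm_lt {x y : K} (h : ‖x‖ < ‖y‖) : ‖x - y‖ = ‖y‖ := by
  rw [norm_sub_rev, sub_eq_add_neg]
  exact norm_add_eq_left_of_norm_lt (by simpa using h)

theorem norm_natCast_eq_one_of_not_dvd {p : ℕ} (hp : p.Prime) (hpn : ‖(p : K)‖ < 1) {u : ℕ}
    (hu : ¬ p ∣ u) : ‖(u : K)‖ = 1 := by
  refine le_antisymm (IsUltrametricDist.norm_natCast_le_one K u) ?_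
  by_contra! hlt
  have hcop : IsCoprime (u : ℤ) (p : ℤ) :=
    Nat.isCoprime_iff_coprime.2 ((Nat.Prime.coprime_iff_not_dvd hp).2 hu).symm
  obtain ⟨a, b, hab⟩ := hcop
  have hK : (a : K) * u + (b : K) * p = 1 := by exact_mod_cast congrArg (Int.cast : ℤ → K) hab
  have hle : ∀ (z : ℤ) (x : K), ‖x‖ < 1 → ‖(z : K) * x‖ < 1 := fun z x hx => by
    rw [norm_mul]
    exact lt_of_le_of_lt (mul_le_of_le_one_left (norm_nonneg _)
      (IsUltrametricDist.norm_intCast_le_one K z)) hx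
  have h1 := IsUltrametricDist.norm_add_le_max ((a : K) * u) ((b : K) * p)
  rw [hK, norm_one] at h1
  exact absurd (max_lt (hle a u hlt) (hle b p hpn)) (not_lt.2 h1)

theorem norm_one_sub_pow_le {x : K} (hx : ‖x‖ ≤ 1) (n : ℕ) : ‖1 - x ^ n‖ ≤ ‖1 - x‖ := by
  rw [← mul_neg_geom_sum, norm_mul]
  refine mul_le_of_le_one_right (norm_nonneg _) ?_
  exact IsUltrametricDist.norm_sum_le_of_forall_le_of_nonneg zero_le_one
    fun i _ => by simpa using pow_le_one₀ (norm_nonneg x) hx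

theorem norm_eq_one_of_norm_one_sub_lt {x : K} (hx : ‖1 - x‖ < 1) : ‖x‖ = 1 := by
  rw [norm_sub_rev] at hx
  simpa using norm_eq_of_norm_sub_lt (x := x) (y := 1) (by simpa using hx)

theorem norm_geom_sum_sub_natCast_le {x : K} (hx : ‖x‖ ≤ 1) (n : ℕ) :
    ‖∑ i ∈ Finset.range n, x ^ i - (n : K)‖ ≤ ‖1 - x‖ := by
  have h : ∑ i ∈ Finset.range n, x ^ i - (n : K) = ∑ i ∈ Finset.range n, (x ^ i - 1) := by simp
  rw [h]
  refine IsUltrametricDist.norm_sum_le_of_forall_le_of_nonneg (norm_nonneg _) fun i _ => ?_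
  rw [norm_sub_rev]
  exact norm_one_sub_pow_le hx i

theorem norm_one_sub_pow_of_not_dvd {p : ℕ} (hp : p.Prime) (hpn : ‖(p : K)‖ < 1) {x : K}
    (hx : ‖1 - x‖ < 1) {u : ℕ} (hu : ¬ p ∣ u) : ‖1 - x ^ u‖ = ‖1 - x‖ := by
  have hu1 := norm_natCast_eq_one_of_not_dvd hp hpn hu
  have h := norm_geom_sum_sub_natCast_le (norm_eq_one_of_norm_one_sub_lt hx).le u
  have hsum := norm_eq_of_norm_sub_lt (hu1.symm ▸ h.trans_lt hx)
  rw [← mul_neg_geom_sum, norm_mul, hsum, hu1, mul_one]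

theorem norm_one_sub_pow_prime_le_sq {p : ℕ} {x : K} (hx : ‖1 - x‖ < 1)
    (hpx : ‖(p : K)‖ ≤ ‖1 - x‖) : ‖1 - x ^ p‖ ≤ ‖1 - x‖ ^ 2 := by
  rw [← mul_neg_geom_sum, norm_mul, sq]
  refine mul_le_mul_of_nonneg_left ?_ (norm_nonneg _)
  have h := IsUltrametricDist.norm_add_le_max (∑ i ∈ Finset.range p, x ^ i - (p : K)) (p : K)
  rw [sub_add_cancel] at h
  exact h.trans (max_le
    (norm_geom_sum_sub_natCast_le (norm_eq_one_of_norm_one_sub_lt hx).le p) hpx)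

end UltrametricField

section RootsOfUnity

theorem Rr_succ_pos {p : ℕ} (hp : 0 < p) (j : ℕ) : 0 < Rr p (j + 1) := by
  have : (0 : ℝ) < p := by exact_mod_cast hp
  simp only [Rr, Nat.succ_ne_zero, if_false]
  positivity

theorem Rr_succ_pow_totient {p : ℕ} (hp : p.Prime) (j : ℕ) :
    Rr p (j + 1) ^ (p ^ (j + 1)).totient = (p : ℝ)⁻¹ := by
  have hp1 : (1 : ℝ) < p := by exact_mod_cast hp.one_lt
  have h1 : (p : ℝ) - 1 ≠ 0 := by linarith
  rw [Nat.totient_prime_pow_succ hp, Rr, if_neg (Nat.succ_ne_zero j), ← Real.rpow_natCast,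
    ← Real.rpow_mul (by positivity)]
  push_cast [Nat.cast_sub hp.one_lt.le]
  rw [div_mul_cancel₀ _ (by positivity), Real.rpow_neg_one]

theorem Rr_strictMono {p : ℕ} (hp : p.Prime) : StrictMono (Rr p) := by
  have hp1 : (1 : ℝ) < p := by exact_mod_cast hp.one_lt
  refine strictMono_nat_of_lt_succ fun j => ?_
  rcases j with _ | j
  · simpa [Rr] using Rr_succ_pos hp.pos 0
  · simp only [Rr, Nat.succ_ne_zero, if_false, Nat.add_sub_cancel]
    refine Real.rpow_lt_rpow_of_exponent_lt hp1 ?_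
    rw [neg_div, neg_div, neg_lt_neg_iff]
    have h1 : 0 < (p : ℝ) - 1 := by linarith
    gcongr
    exact j.lt_succ_self

theorem Rr_mono {p : ℕ} (hp : p.Prime) : Monotone (Rr p) := (Rr_strictMono hp).monotone

variable {K : Type*} [NontriviallyNormedField K]

theorem exists_primitiveRoot_prime_pow [IsAlgClosed K] {p : ℕ} (hp : p.Prime)
    (hpn : ‖(p : K)‖ = (p : ℝ)⁻¹) (j : ℕ) : ∃ z : K, IsPrimitiveRoot z (p ^ j) := by
  have hp0 : (p : K) ≠ 0 := by
    rw [← norm_ne_zero_iff, hpn]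
    exact inv_ne_zero (by exact_mod_cast hp.ne_zero)
  have : NeZero ((p ^ j : ℕ) : K) := ⟨by push_cast; exact pow_ne_zero _ hp0⟩
  exact HasEnoughRootsOfUnity.exists_primitiveRoot K (p ^ j)

theorem norm_one_sub_pow_of_forall_root [IsAlgClosed K] {p : ℕ} (hp : p.Prime)
    (hpn : ‖(p : K)‖ = (p : ℝ)⁻¹) {x : K} {j : ℕ} {d : ℝ}
    (hx : ∀ z : K, z ^ p ^ j = 1 → ‖x - z‖ = d) : ‖1 - x ^ p ^ j‖ = d ^ p ^ j := by
  obtain ⟨z, hz⟩ := exists_primitiveRoot_prime_pow (K := K) hp hpn j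
  have hpos := pow_pos hp.pos j
  have hev := congrArg (Polynomial.eval x) (Polynomial.X_pow_sub_one_eq_prod hpos hz)
  simp only [Polynomial.eval_sub, Polynomial.eval_pow, Polynomial.eval_X,
    Polynomial.eval_one, Polynomial.eval_prod, Polynomial.eval_C] at hev
  rw [norm_sub_rev, hev, norm_prod, Finset.prod_congr rfl
    (fun y hy => hx y ((Polynomial.mem_nthRootsFinset hpos 1).1 hy)), Finset.prod_const,
    hz.card_nthRootsFinset]

variable [IsUltrametricDist K]

theorem IsPrimitiveRoot.norm_one_sub_eq_Rr {p : ℕ} (hp : p.Prime) (hpn : ‖(p : K)‖ = (p : ℝ)⁻¹)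
    {z : K} {j : ℕ} (hz : IsPrimitiveRoot z (p ^ (j + 1))) : ‖1 - z‖ = Rr p (j + 1) := by
  have := Fact.mk hp
  have hle : ∀ x y : K, IsPrimitiveRoot x (p ^ (j + 1)) → IsPrimitiveRoot y (p ^ (j + 1)) →
      ‖1 - y‖ ≤ ‖1 - x‖ := by
    intro x y hx hy
    have : NeZero (p ^ (j + 1)) := ⟨pow_ne_zero _ hp.ne_zero⟩
    obtain ⟨i, -, rfl⟩ := hx.eq_pow_of_pow_eq_one hy.pow_eq_one
    exact norm_one_sub_pow_le (IsOfFinOrder.norm_eq_one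
      (isOfFinOrder_iff_pow_eq_one.2 ⟨_, pow_pos hp.pos _, hx.pow_eq_one⟩)).le i
  have hprod := Polynomial.eval_one_cyclotomic_prime_pow (R := K) (p := p) j
  rw [Polynomial.cyclotomic_eq_prod_X_sub_primitiveRoots hz, Polynomial.eval_prod] at hprod
  have hnorm : ‖1 - z‖ ^ (p ^ (j + 1)).totient = (p : ℝ)⁻¹ := by
    rw [← hpn, ← hprod, norm_prod, ← hz.card_primitiveRoots, ← Finset.prod_const]
    refine Finset.prod_congr rfl fun y hy => ?_
    have hy' := (mem_primitiveRoots (pow_pos hp.pos _)).1 hy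
    simpa using le_antisymm (hle y z hy' hz) (hle z y hz hy')
  rw [← Rr_succ_pow_totient hp j] at hnorm
  exact (pow_left_inj₀ (norm_nonneg _) (Rr_succ_pos hp.pos j).le
    (Nat.totient_pos.2 (pow_pos hp.pos _)).ne').1 hnorm

theorem norm_one_sub_root_le_Rr {p : ℕ} (hp : p.Prime) (hpn : ‖(p : K)‖ = (p : ℝ)⁻¹)
    {z : K} {j : ℕ} (hz : z ^ p ^ j = 1) : ‖1 - z‖ ≤ Rr p j := by
  obtain ⟨i, hij, hi⟩ := (Nat.dvd_prime_pow hp).1 (orderOf_dvd_of_pow_eq_one hz)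
  have hprim := IsPrimitiveRoot.iff_orderOf.2 hi
  rcases i with _ | i
  · have : z = 1 := by simpa using hprim.pow_eq_one
    subst this
    simpa [Rr] using Rr_mono hp (Nat.zero_le j)
  · rw [hprim.norm_one_sub_eq_Rr hp hpn]
    exact Rr_mono hp hij

theorem pow_eq_one_of_norm_one_sub_lt_Rr {p : ℕ} (hp : p.Prime) (hpn : ‖(p : K)‖ = (p : ℝ)⁻¹)
    {z : K} {j : ℕ} (hz : z ∈ GammaR p K) (hlt : ‖1 - z‖ < Rr p (j + 1)) : z ^ p ^ j = 1 := by
  obtain ⟨k, hk⟩ := hz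
  obtain ⟨i, hik, hi⟩ := (Nat.dvd_prime_pow hp).1 (orderOf_dvd_of_pow_eq_one hk)
  have hprim := IsPrimitiveRoot.iff_orderOf.2 hi
  have hij : i ≤ j := by
    rcases i with _ | i
    · exact Nat.zero_le j
    · rw [hprim.norm_one_sub_eq_Rr hp hpn] at hlt
      exact Nat.lt_succ_iff.1 ((Rr_strictMono hp).lt_iff_lt.1 hlt)
  exact orderOf_dvd_iff_pow_eq_one.1 (hi ▸ pow_dvd_pow p hij)

theorem norm_one_sub_pow_succ_of_lt_Rr [IsAlgClosed K] {p : ℕ} (hp : p.Prime)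
    (hpn : ‖(p : K)‖ = (p : ℝ)⁻¹) {x : K} {j : ℕ} (hx : ‖1 - x‖ < Rr p (j + 1)) :
    ‖1 - x ^ p ^ (j + 1)‖ = (p : ℝ)⁻¹ * ‖1 - x ^ p ^ j‖ := by
  have := Fact.mk hp
  obtain ⟨z, hz⟩ := exists_primitiveRoot_prime_pow (K := K) hp hpn (j + 1)
  have hev := congrArg (Polynomial.eval x)
    (Polynomial.cyclotomic_prime_pow_mul_X_pow_sub_one K p j)
  simp only [Polynomial.eval_mul, Polynomial.eval_sub, Polynomial.eval_pow, Polynomial.eval_X,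
    Polynomial.eval_one] at hev
  rw [norm_sub_rev, ← hev, norm_mul, norm_sub_rev (x ^ p ^ j),
    Polynomial.cyclotomic_eq_prod_X_sub_primitiveRoots hz, Polynomial.eval_prod, norm_prod,
    ← Rr_succ_pow_totient hp j, ← hz.card_primitiveRoots, ← Finset.prod_const]
  congr 1
  refine Finset.prod_congr rfl fun y hy => ?_
  have hy' := (mem_primitiveRoots (pow_pos hp.pos _)).1 hy
  have hyR := hy'.norm_one_sub_eq_Rr hp hpn
  rw [← hyR] at hx ⊢
  have := norm_sub_eq_right_of_norm_lt hx
  simpa [norm_sub_rev] using this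

theorem norm_one_sub_pow_add_of_lt_Rr [IsAlgClosed K] {p : ℕ} (hp : p.Prime)
    (hpn : ‖(p : K)‖ = (p : ℝ)⁻¹) {x : K} {j : ℕ} (hx : ‖1 - x‖ < Rr p (j + 1)) (i : ℕ) :
    ‖1 - x ^ p ^ (j + i)‖ = (p : ℝ)⁻¹ ^ i * ‖1 - x ^ p ^ j‖ := by
  induction i with
  | zero => simp
  | succ i ih =>
    rw [← add_assoc, norm_one_sub_pow_succ_of_lt_Rr hp hpn
      (hx.trans_le (Rr_mono hp (by omega))), ih]
    ring

end RootsOfUnity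

section FormalConjugacy

theorem coeff_mk_pow_eq_zero_of_lt {R : Type*} [CommRing R] {c : ℕ → R} (hc0 : c 0 = 0)
    {k l : ℕ} (h : k < l) : PowerSeries.coeff k (PowerSeries.mk c ^ l) = 0 := by
  have hX : PowerSeries.X ∣ PowerSeries.mk c := by
    rw [PowerSeries.X_dvd_iff]; simp [hc0]
  exact PowerSeries.X_pow_dvd_iff.1 (pow_dvd_pow_of_dvd hX l) k h

theorem coeff_add_mk_pow {R : Type*} [CommRing R] {c : ℕ → R} (hc0 : c 0 = 0) (n l : ℕ) :
    PowerSeries.coeff (n + l) (PowerSeries.mk c ^ l) =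
      PowerSeries.coeff n (PowerSeries.mk (fun i => c (i + 1)) ^ l) := by
  have hX : PowerSeries.mk c = PowerSeries.mk (fun i => c (i + 1)) * PowerSeries.X := by
    ext n
    rcases n with _ | n <;> simp [PowerSeries.coeff_succ_mul_X, hc0]
  rw [hX, mul_pow, PowerSeries.coeff_mul_X_pow]

theorem coeff_zero_mk_pow {R : Type*} [CommRing R] (d : ℕ → R) (l : ℕ) :
    PowerSeries.coeff 0 (PowerSeries.mk d ^ l) = d 0 ^ l := by
  simp

theorem coeff_one_mk_pow {R : Type*} [CommRing R] (d : ℕ → R) (l : ℕ) :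
    PowerSeries.coeff 1 (PowerSeries.mk d ^ (l + 1)) = (l + 1) * d 0 ^ l * d 1 := by
  induction l with
  | zero => simp
  | succ l ih =>
    rw [pow_succ, PowerSeries.coeff_mul, Finset.Nat.sum_antidiagonal_eq_sum_range_succ_mk]
    simp only [Finset.sum_range_succ, Finset.sum_range_zero, zero_add, tsub_zero, tsub_self, ih,
      coeff_zero_mk_pow, PowerSeries.coeff_mk]
    push_cast
    ring

theorem two_mul_coeff_two_mk_pow {R : Type*} [CommRing R] (d : ℕ → R) (l : ℕ) :
    2 * PowerSeries.coeff 2 (PowerSeries.mk d ^ (l + 2)) =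
      (l + 2) * d 0 ^ l * (2 * d 0 * d 2 + (l + 1) * d 1 ^ 2) := by
  have hmul : ∀ φ : PowerSeries R, PowerSeries.coeff 2 (φ * PowerSeries.mk d) =
      PowerSeries.coeff 0 φ * d 2 + PowerSeries.coeff 1 φ * d 1 + PowerSeries.coeff 2 φ * d 0 := by
    intro φ
    rw [PowerSeries.coeff_mul, Finset.Nat.sum_antidiagonal_eq_sum_range_succ_mk]
    simp [Finset.sum_range_succ]
  induction l with
  | zero =>
    rw [zero_add, sq, hmul]
    simp only [PowerSeries.coeff_mk]
    push_cast
    ring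
  | succ l ih =>
    rw [show l + 1 + 2 = (l + 2) + 1 from rfl, pow_succ, hmul, mul_add, ← mul_assoc, ih,
      coeff_zero_mk_pow, coeff_one_mk_pow]
    push_cast
    ring

theorem norm_coeff_mk_pow_le_one {K : Type*} [NontriviallyNormedField K] [IsUltrametricDist K]
    {c : ℕ → K} (hc : ∀ i, ‖c i‖ ≤ 1) (k l : ℕ) :
    ‖PowerSeries.coeff k (PowerSeries.mk c ^ l)‖ ≤ 1 := by
  induction l generalizing k with
  | zero =>
    rw [pow_zero, PowerSeries.coeff_one]
    split_ifs <;> simp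
  | succ l ih =>
    rw [pow_succ, PowerSeries.coeff_mul]
    refine IsUltrametricDist.norm_sum_le_of_forall_le_of_nonneg zero_le_one fun i _ => ?_
    rw [norm_mul, PowerSeries.coeff_mk]
    exact mul_le_one₀ (ih _) (norm_nonneg _) (hc _)

theorem norm_sum_lt_of_forall_lt {K ι : Type*} [NontriviallyNormedField K] [IsUltrametricDist K]
    {s : Finset ι} {f : ι → K} {B : ℝ} (hB : 0 < B) (h : ∀ i ∈ s, ‖f i‖ < B) :
    ‖∑ i ∈ s, f i‖ < B := by
  induction s using Finset.cons_induction with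
  | empty => simpa using hB
  | cons a s ha ih =>
    rw [Finset.sum_cons]
    exact (IsUltrametricDist.norm_add_le_max _ _).trans_lt (max_lt (h a (by simp))
      (ih fun i hi => h i (by simp [hi])))

/-- The coefficients of the normalized formal linearizing conjugacy. -/
noncomputable def conjugacyCoeff {K : Type*} [Field K] (lam : K) (c : ℕ → K) : ℕ → K
  | 0 => 0
  | 1 => 1
  | k + 2 => (∑ l : Fin (k + 2), conjugacyCoeff lam c l *
      PowerSeries.coeff (k + 2) (PowerSeries.mk c ^ (l : ℕ))) / (lam - lam ^ (k + 2))

theorem coeff_self_mk_pow {R : Type*} [CommRing R] {c : ℕ → R} (hc0 : c 0 = 0) (k : ℕ) :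
    PowerSeries.coeff k (PowerSeries.mk c ^ k) = c 1 ^ k := by
  have := coeff_add_mk_pow hc0 0 k
  rw [zero_add] at this
  rw [this, coeff_zero_mk_pow]

theorem isConjugacy_conjugacyCoeff {K : Type*} [Field K] {lam : K} {c : ℕ → K}
    (hlam0 : lam ≠ 0) (hroot : ∀ n : ℕ, 1 ≤ n → lam ^ n ≠ 1) (hc0 : c 0 = 0) (hc1 : c 1 = lam) :
    IsConjugacy lam c (conjugacyCoeff lam c) := by
  refine ⟨by rw [conjugacyCoeff], by rw [conjugacyCoeff], fun k => ?_⟩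
  rw [compCoeff, Finset.sum_range_succ, coeff_self_mk_pow hc0, hc1]
  rcases k with _ | _ | k
  · simp [conjugacyCoeff]
  · simp [conjugacyCoeff]
  · have hne : lam - lam ^ (k + 2) ≠ 0 := by
      rw [pow_succ', ← mul_one_sub]
      exact mul_ne_zero hlam0 (sub_ne_zero.2 (hroot (k + 1) (by omega)).symm)
    rw [Finset.sum_range, ← sub_eq_zero]
    have h : conjugacyCoeff lam c (k + 2) * (lam - lam ^ (k + 2)) =
        ∑ l : Fin (k + 2), conjugacyCoeff lam c l *
          PowerSeries.coeff (k + 2) (PowerSeries.mk c ^ (l : ℕ)) := by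
      rw [conjugacyCoeff, div_mul_cancel₀ _ hne]
    rw [← h]
    ring

theorem IsConjugacy.recursion {K : Type*} [Field K] {lam : K} {c b : ℕ → K}
    (hb : IsConjugacy lam c b) (hc0 : c 0 = 0) (hc1 : c 1 = lam) (k : ℕ) :
    lam * (1 - lam ^ k) * b (k + 1) = ∑ l ∈ Finset.range (k + 1),
      b l * PowerSeries.coeff (k + 1) (PowerSeries.mk c ^ l) := by
  have h := hb.2.2 (k + 1)
  rw [compCoeff, Finset.sum_range_succ, coeff_self_mk_pow hc0, hc1] at h
  linear_combination -h

/-- The absolute value of the coefficient of `x ^ (n + 1)` in the linearizing conjugacy. -/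
noncomputable def conjugacyNorm {K : Type*} [NontriviallyNormedField K] (p : ℕ) (lam : K)
    (n : ℕ) : ℝ :=
  ∏ j ∈ Finset.range n, (if p ∣ j + 1 then ‖1 - lam‖ else 1) / ‖1 - lam ^ (j + 1)‖

variable {K : Type*} [NontriviallyNormedField K] {p : ℕ} {lam : K}

theorem conjugacyNorm_succ (n : ℕ) : conjugacyNorm p lam (n + 1) =
    conjugacyNorm p lam n * ((if p ∣ n + 1 then ‖1 - lam‖ else 1) / ‖1 - lam ^ (n + 1)‖) :=
  Finset.prod_range_succ _ _

theorem norm_one_sub_pow_pos (hroot : ∀ n : ℕ, 1 ≤ n → lam ^ n ≠ 1) {n : ℕ} (hn : 1 ≤ n) :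
    0 < ‖1 - lam ^ n‖ :=
  norm_pos_iff.2 (sub_ne_zero.2 (hroot n hn).symm)

theorem conjugacyNorm_pos (hroot : ∀ n : ℕ, 1 ≤ n → lam ^ n ≠ 1) (n : ℕ) :
    0 < conjugacyNorm p lam n := by
  refine Finset.prod_pos fun j _ => ?_
  have h1 := norm_one_sub_pow_pos hroot (le_refl 1)
  rw [pow_one] at h1
  have h2 := norm_one_sub_pow_pos hroot (Nat.le_add_left 1 j)
  split_ifs <;> positivity

variable [IsUltrametricDist K]

theorem conjugacyNorm_strictMono (hpn : ‖(p : K)‖ ≤ ‖1 - lam‖)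
    (hroot : ∀ n : ℕ, 1 ≤ n → lam ^ n ≠ 1) (hlam : ‖1 - lam‖ < 1) :
    StrictMono (conjugacyNorm p lam) := by
  refine strictMono_nat_of_lt_succ fun n => ?_
  rw [conjugacyNorm_succ]
  refine lt_mul_of_one_lt_right (conjugacyNorm_pos hroot n) ?_
  rw [one_lt_div (norm_one_sub_pow_pos hroot (Nat.le_add_left 1 n))]
  have hle1 := (norm_eq_one_of_norm_one_sub_lt hlam).le
  have hpos := norm_one_sub_pow_pos hroot (le_refl 1)
  rw [pow_one] at hpos
  split_ifs with hdvd
  · obtain ⟨u, hu⟩ := hdvd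
    rw [hu, pow_mul]
    have h1 : ‖lam ^ p‖ ≤ 1 := by simpa using pow_le_one₀ (norm_nonneg _) hle1
    calc _ ≤ ‖1 - lam ^ p‖ := norm_one_sub_pow_le h1 u
      _ ≤ ‖1 - lam‖ ^ 2 := norm_one_sub_pow_prime_le_sq hlam hpn
      _ < ‖1 - lam‖ := by nlinarith
  · exact (norm_one_sub_pow_le hle1 _).trans_lt hlam

theorem IsConjugacy.norm_eq (hp : p.Prime) (hp3 : 3 ≤ p)
    (hroot : ∀ n : ℕ, 1 ≤ n → lam ^ n ≠ 1)
    (hlam1 : ‖(p : K)‖ < ‖1 - lam‖) (hlam2 : ‖1 - lam‖ < 1)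
    {c b : ℕ → K} (hc0 : c 0 = 0) (hc1 : c 1 = lam) (hc : ∀ i, ‖c i‖ ≤ 1)
    (hc2 : ‖c 2‖ = 1) (hc3 : ‖c 2 ^ 2 - c 3‖ = 1) (hb : IsConjugacy lam c b) (n : ℕ) :
    ‖b (n + 1)‖ = conjugacyNorm p lam n := by
  have hp1 : ‖(p : K)‖ < 1 := hlam1.trans hlam2
  have hl1 := norm_eq_one_of_norm_one_sub_lt hlam2
  have hmono := conjugacyNorm_strictMono hlam1.le hroot hlam2
  have hWpos := conjugacyNorm_pos (p := p) hroot
  have hdvdle : ∀ {q : ℕ}, p ∣ q → ‖(q : K)‖ ≤ ‖(p : K)‖ := by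
    rintro _ ⟨u, rfl⟩
    push_cast
    rw [norm_mul]
    exact mul_le_of_le_one_right (norm_nonneg _) (IsUltrametricDist.norm_natCast_le_one K u)
  induction n using Nat.strong_induction_on with
  | _ n ih =>
  rcases n with _ | n
  · simp [hb.2.1, conjugacyNorm]
  have hrec := hb.recursion hc0 hc1 (n + 1)
  have hd := norm_one_sub_pow_pos hroot (Nat.le_add_left 1 n)
  have hsmall : ∀ N ≤ n, ‖∑ l ∈ Finset.range (N + 1),
      b l * PowerSeries.coeff (n + 2) (PowerSeries.mk c ^ l)‖ < conjugacyNorm p lam N := by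
    intro N hN
    refine norm_sum_lt_of_forall_lt (hWpos N) fun l hl => ?_
    rw [Finset.mem_range] at hl
    rcases l with _ | l
    · simpa [hb.1] using hWpos N
    · rw [norm_mul, ih l (by omega)]
      exact (mul_le_of_le_one_right (hWpos l).le (norm_coeff_mk_pow_le_one hc _ _)).trans_lt
        (hmono (by omega))
  have hone : ∀ N, PowerSeries.coeff (N + 2) (PowerSeries.mk c ^ (N + 1)) =
      ((N + 1 : ℕ) : K) * lam ^ N * c 2 := by
    intro N
    have := coeff_add_mk_pow hc0 1 (N + 1)
    rw [show 1 + (N + 1) = N + 2 by ring, coeff_one_mk_pow] at this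
    simpa [hc1] using this
  suffices hsum : ‖∑ l ∈ Finset.range (n + 2),
      b l * PowerSeries.coeff (n + 2) (PowerSeries.mk c ^ l)‖ =
      conjugacyNorm p lam n * (if p ∣ n + 1 then ‖1 - lam‖ else 1) by
    rw [conjugacyNorm_succ, ← mul_div_assoc, ← hsum, eq_div_iff hd.ne', ← hrec, norm_mul,
      norm_mul, hl1]
    ring
  have hlast : ‖b (n + 1) * PowerSeries.coeff (n + 2) (PowerSeries.mk c ^ (n + 1))‖ =
      conjugacyNorm p lam n * ‖((n + 1 : ℕ) : K)‖ := by
    rw [hone, norm_mul, ih n (by omega), norm_mul, norm_mul, norm_pow, hl1, hc2]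
    ring
  rw [Finset.sum_range_succ]
  split_ifs with hdvd
  · obtain ⟨l, rfl⟩ : ∃ l, n = l + 2 := ⟨n - 2, by have := Nat.le_of_dvd (by omega) hdvd; omega⟩
    have hndvd : ¬ p ∣ l + 2 := fun h => by
      have := (Nat.dvd_add_right h).1 hdvd
      exact hp.one_lt.ne' (Nat.dvd_one.1 this)
    have hW : conjugacyNorm p lam (l + 2) * ‖1 - lam‖ = conjugacyNorm p lam (l + 1) := by
      rw [conjugacyNorm_succ, if_neg hndvd, norm_one_sub_pow_of_not_dvd hp hp1 hlam2 hndvd]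
      have : ‖1 - lam‖ ≠ 0 := by simpa using (norm_one_sub_pow_pos hroot (le_refl 1)).ne'
      field_simp
    have h2 : ‖(2 : K)‖ = 1 := by
      exact_mod_cast norm_natCast_eq_one_of_not_dvd hp hp1
        (u := 2) (fun h => by have := Nat.le_of_dvd (by omega) h; omega)
    have htwo : ‖PowerSeries.coeff (l + 2 + 2) (PowerSeries.mk c ^ (l + 2))‖ = 1 := by
      have hco := coeff_add_mk_pow hc0 2 (l + 2)
      rw [show 2 + (l + 2) = l + 2 + 2 by ring] at hco
      have heq := two_mul_coeff_two_mk_pow (fun i => c (i + 1)) l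
      rw [← hco] at heq
      have hn := congrArg norm heq
      have hunit : ‖(l + 2 : K)‖ = 1 := by
        exact_mod_cast norm_natCast_eq_one_of_not_dvd hp hp1 hndvd
      simp only [norm_mul, norm_pow, h2, one_mul, zero_add, hc1, hl1, one_pow, mul_one,
        hunit] at hn
      rw [hn]
      have hmain : ‖-2 * (c 2 ^ 2 - c 3)‖ = 1 := by rw [norm_mul, norm_neg, h2, hc3, one_mul]
      rw [← hmain]
      refine norm_eq_of_norm_sub_lt ?_
      rw [hmain]
      have hsplit : 2 * lam * c (2 + 1) + (l + 1) * c (1 + 1) ^ 2 - -2 * (c 2 ^ 2 - c 3) =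
          -2 * (1 - lam) * c 3 + ((l + 2 + 1 : ℕ) : K) * c 2 ^ 2 := by
        push_cast
        ring
      rw [hsplit]
      refine (IsUltrametricDist.norm_add_le_max _ _).trans_lt (max_lt ?_ ?_)
      · rw [norm_mul, norm_mul, norm_neg, h2, one_mul]
        exact (mul_le_of_le_one_right (norm_nonneg _) (hc 3)).trans_lt hlam2
      · rw [norm_mul, norm_pow, hc2, one_pow, mul_one]
        exact (hdvdle hdvd).trans_lt hp1
    rw [hW, Finset.sum_range_succ, add_right_comm]
    have hmain : ‖b (l + 2) * PowerSeries.coeff (l + 2 + 2) (PowerSeries.mk c ^ (l + 2))‖ =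
        conjugacyNorm p lam (l + 1) := by rw [norm_mul, htwo, mul_one, ih (l + 1) (by omega)]
    have hrest : ‖∑ l_1 ∈ Finset.range (l + 2), b l_1 *
        PowerSeries.coeff (l + 2 + 2) (PowerSeries.mk c ^ l_1) + b (l + 2 + 1) *
        PowerSeries.coeff (l + 2 + 2) (PowerSeries.mk c ^ (l + 2 + 1))‖ <
        conjugacyNorm p lam (l + 1) := by
      refine (IsUltrametricDist.norm_add_le_max _ _).trans_lt
        (max_lt (hsmall (l + 1) (by omega)) ?_)
      rw [hlast, ← hW]
      exact mul_lt_mul_of_pos_left ((hdvdle hdvd).trans_lt hlam1) (hWpos _)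
    rw [add_comm, norm_add_eq_left_of_norm_lt (hmain.symm ▸ hrest), hmain]
  · rw [norm_natCast_eq_one_of_not_dvd hp hp1 hdvd, mul_one] at hlast
    rw [mul_one, add_comm, norm_add_eq_left_of_norm_lt (hlast.symm ▸ hsmall n le_rfl), hlast]

end FormalConjugacy

section FloorSums

/-- The increments of a sequence, the first one being its initial value. -/
def increment (A : ℕ → ℝ) : ℕ → ℝ
  | 0 => A 0
  | i + 1 => A (i + 1) - A i

theorem sum_range_increment (A : ℕ → ℝ) (k : ℕ) :
    ∑ i ∈ Finset.range (k + 1), increment A i = A k := by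
  induction k with
  | zero => simp [increment]
  | succ k ih => rw [Finset.sum_range_succ, ih]; simp [increment]

theorem sum_padicValNat_eq_sum_increment {p : ℕ} (hp : p.Prime) (A : ℕ → ℝ) (N n : ℕ)
    (hn : n < p ^ N) :
    ∑ j ∈ Finset.range n, A (padicValNat p (j + 1)) =
      ∑ i ∈ Finset.range N, increment A i * ((n / p ^ i : ℕ) : ℝ) := by
  have := Fact.mk hp
  induction n with
  | zero => simp
  | succ n ih =>
    have hv : padicValNat p (n + 1) < N := by
      by_contra! h
      exact absurd (Nat.le_of_dvd (Nat.succ_pos n)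
        ((padicValNat_dvd_iff_le (Nat.succ_ne_zero n)).2 h)) (not_le.2 hn)
    rw [Finset.sum_range_succ, ih (by omega), ← sum_range_increment A (padicValNat p (n + 1))]
    have hsub : Finset.range (padicValNat p (n + 1) + 1) =
        (Finset.range N).filter fun i => p ^ i ∣ n + 1 := by
      ext i
      simp only [Finset.mem_range, Finset.mem_filter,
        padicValNat_dvd_iff_le n.add_one_ne_zero]
      omega
    rw [hsub, Finset.sum_filter, ← Finset.sum_add_distrib]
    refine Finset.sum_congr rfl fun i _ => ?_
    rw [Nat.succ_div]
    split_ifs <;> push_cast <;> ring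

theorem sum_increment_div_pow {p s : ℕ} (hp : p.Prime) {V : ℕ → ℝ} {D : ℝ}
    (hlow : ∀ i < s, V i = (p : ℝ) ^ i * V 0) (hhigh : ∀ i, V (s + i) = V s + i * D) (i : ℕ) :
    ∑ j ∈ Finset.range (s + i + 1), increment V j / (p : ℝ) ^ j =
      V 0 * (s * ((p - 1) / p)) + V s / (p : ℝ) ^ s + D / ((p : ℝ) ^ s * (p - 1)) -
        D / ((p : ℝ) ^ (s + i) * (p - 1)) := by
  have hp1 : (1 : ℝ) < p := by exact_mod_cast hp.one_lt
  have hp0 : (p : ℝ) ≠ 0 := by linarith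
  have hp2 : (p : ℝ) - 1 ≠ 0 := by linarith
  have hlow' : ∀ k < s, ∑ j ∈ Finset.range (k + 1), increment V j / (p : ℝ) ^ j =
      V 0 * (1 + k * ((p - 1) / p)) := by
    intro k
    induction k with
    | zero => intro _; simp [increment]
    | succ k ih =>
      intro hk
      rw [Finset.sum_range_succ, ih (by omega), increment, hlow (k + 1) hk, hlow k (by omega)]
      field_simp
      push_cast
      ring
  induction i with
  | zero =>
    rw [add_zero, add_sub_cancel_right]
    rcases s with _ | k
    · simp [increment]
    · rw [Finset.sum_range_succ, hlow' k (by omega), increment, hlow k (by omega)]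
      field_simp
      push_cast
      ring
  | succ i ih =>
    rw [Finset.sum_range_succ, show s + (i + 1) = s + i + 1 from rfl, ih, increment, hhigh i,
      show s + i + 1 = s + (i + 1) from rfl, hhigh (i + 1)]
    field_simp
    push_cast
    ring

end FloorSums

section ConjugacyNormGrowth

variable {K : Type*} [NontriviallyNormedField K] {p : ℕ} {lam : K}

/-- Minus the logarithm of `|1 - λ ^ (p ^ i)|`. -/
noncomputable def negLogNorm (p : ℕ) (lam : K) (i : ℕ) : ℝ := -Real.log ‖1 - lam ^ p ^ i‖

/-- The logarithm of the factor by which `conjugacyNorm` grows at an index of `p`-adic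
valuation `i`. -/
noncomputable def logGrowth (p : ℕ) (lam : K) (i : ℕ) : ℝ :=
  negLogNorm p lam i - if i = 0 then 0 else negLogNorm p lam 0

theorem sum_increment_logGrowth_div_pow (p : ℕ) (lam : K) {N : ℕ} (hN : 1 ≤ N) :
    ∑ j ∈ Finset.range (N + 1), increment (logGrowth p lam) j / (p : ℝ) ^ j =
      ∑ j ∈ Finset.range (N + 1), increment (negLogNorm p lam) j / (p : ℝ) ^ j -
        negLogNorm p lam 0 / p := by
  induction N, hN using Nat.le_induction with
  | base =>
    simp [Finset.sum_range_succ, increment, logGrowth]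
    ring
  | succ N hN ih =>
    rw [Finset.sum_range_succ, ih, Finset.sum_range_succ _ (N + 1)]
    simp only [increment, logGrowth, Nat.succ_ne_zero, if_false,
      if_neg (Nat.one_le_iff_ne_zero.1 hN)]
    ring

variable [IsUltrametricDist K]

theorem norm_one_sub_pow_eq_padicValNat (hp : p.Prime) (hp1 : ‖(p : K)‖ < 1)
    (hlam : ‖1 - lam‖ < 1) {j : ℕ} (hj : j ≠ 0) :
    ‖1 - lam ^ j‖ = ‖1 - lam ^ p ^ padicValNat p j‖ := by
  have := Fact.mk hp
  obtain ⟨u, hu⟩ := pow_padicValNat_dvd (p := p) (n := j)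
  have hndvd : ¬ p ∣ u := by
    intro h
    refine pow_succ_padicValNat_not_dvd (p := p) hj ?_
    rw [pow_succ]
    nth_rw 2 [hu]
    exact Nat.mul_dvd_mul_left _ h
  conv_lhs => rw [hu, pow_mul]
  exact norm_one_sub_pow_of_not_dvd hp hp1
    ((norm_one_sub_pow_le (norm_eq_one_of_norm_one_sub_lt hlam).le _).trans_lt hlam) hndvd

theorem log_conjugacyNorm (hp : p.Prime) (hp1 : ‖(p : K)‖ < 1)
    (hroot : ∀ n : ℕ, 1 ≤ n → lam ^ n ≠ 1) (hlam : ‖1 - lam‖ < 1) (n : ℕ) :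
    Real.log (conjugacyNorm p lam n) =
      ∑ j ∈ Finset.range n, logGrowth p lam (padicValNat p (j + 1)) := by
  have hpos := norm_one_sub_pow_pos hroot (le_refl 1)
  rw [pow_one] at hpos
  have hd := fun j => norm_one_sub_pow_pos hroot (Nat.le_add_left 1 j)
  rw [conjugacyNorm, Real.log_prod fun j _ => div_ne_zero
    (by split_ifs; exacts [hpos.ne', one_ne_zero]) (hd j).ne']
  refine Finset.sum_congr rfl fun j _ => ?_
  rw [Real.log_div (by split_ifs; exacts [hpos.ne', one_ne_zero]) (hd j).ne', logGrowth,
    negLogNorm, negLogNorm, ← norm_one_sub_pow_eq_padicValNat hp hp1 hlam (Nat.succ_ne_zero j)]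
  have hiff : padicValNat p (j + 1) = 0 ↔ ¬ p ∣ j + 1 := by
    simp [padicValNat.eq_zero_iff, hp.ne_one]
  by_cases h : p ∣ j + 1
  · rw [if_pos h, if_neg (by tauto)]
    simp only [pow_zero, pow_one]
    ring
  · rw [if_neg h, if_pos (by tauto), Real.log_one]
    ring

theorem increment_logGrowth_nonneg (hpn : ‖(p : K)‖ ≤ ‖1 - lam‖) (hp : p.Prime)
    (hroot : ∀ n : ℕ, 1 ≤ n → lam ^ n ≠ 1) (hlam : ‖1 - lam‖ < 1) (i : ℕ) :
    0 ≤ increment (logGrowth p lam) i := by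
  have hpos := norm_one_sub_pow_pos hroot (le_refl 1)
  rw [pow_one] at hpos
  have hl1 := (norm_eq_one_of_norm_one_sub_lt hlam).le
  rcases i with _ | _ | i
  · simp only [increment, logGrowth, negLogNorm, pow_zero, pow_one, if_true, sub_zero]
    exact neg_nonneg.2 (Real.log_nonpos hpos.le hlam.le)
  · have h := Real.log_le_log (norm_one_sub_pow_pos hroot hp.one_lt.le)
      (norm_one_sub_pow_prime_le_sq hlam hpn)
    rw [Real.log_pow] at h
    push_cast at h
    simp only [increment, logGrowth, negLogNorm, pow_zero, pow_one, if_true, sub_zero, zero_add,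
      one_ne_zero, if_false]
    linarith
  · have h := Real.log_le_log (norm_one_sub_pow_pos hroot (pow_pos hp.pos (i + 2)))
      (show ‖1 - lam ^ p ^ (i + 2)‖ ≤ ‖1 - lam ^ p ^ (i + 1)‖ by
        rw [pow_succ p, pow_mul]
        refine norm_one_sub_pow_le (x := lam ^ p ^ (i + 1)) ?_ p
        simpa using pow_le_one₀ (norm_nonneg _) hl1)
    simp only [increment, logGrowth, negLogNorm, Nat.succ_ne_zero, if_false]
    linarith

/-- The upper bound for `conjugacyNorm`, and its exact value at powers of `p`, in terms of the
closed form of the logarithm of the radius. -/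
theorem conjugacyNorm_growth (hp : p.Prime) (hpn : ‖(p : K)‖ ≤ ‖1 - lam‖)
    (hroot : ∀ n : ℕ, 1 ≤ n → lam ^ n ≠ 1) (hlam : ‖1 - lam‖ < 1) {s : ℕ} {D r : ℝ} (hD : 0 ≤ D)
    (hlow : ∀ i < s, negLogNorm p lam i = (p : ℝ) ^ i * negLogNorm p lam 0)
    (hhigh : ∀ i, negLogNorm p lam (s + i) = negLogNorm p lam s + i * D) (hr : 0 < r)
    (hlogr : -Real.log r = negLogNorm p lam 0 * (s * ((p - 1) / p)) +
      negLogNorm p lam s / (p : ℝ) ^ s + D / ((p : ℝ) ^ s * (p - 1)) - negLogNorm p lam 0 / p) :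
    (∀ n, conjugacyNorm p lam n * r ^ n ≤ 1) ∧
      ∀ i, conjugacyNorm p lam (p ^ (s + i + 1)) * r ^ p ^ (s + i + 1) =
        Real.exp (-(D / (p - 1))) := by
  have hp1 : (1 : ℝ) < p := by exact_mod_cast hp.one_lt
  have hp0 : (p : ℝ) ≠ 0 := by linarith
  have hp2 : (0 : ℝ) < (p : ℝ) - 1 := by linarith
  have hW := conjugacyNorm_pos (p := p) hroot
  have hlog : ∀ n, Real.log (conjugacyNorm p lam n * r ^ n) =
      ∑ j ∈ Finset.range n, logGrowth p lam (padicValNat p (j + 1)) + n * Real.log r := by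
    intro n
    rw [Real.log_mul (hW n).ne' (by positivity), Real.log_pow,
      log_conjugacyNorm hp (hpn.trans_lt hlam) hroot hlam]
  have hsum : ∀ i, ∑ j ∈ Finset.range (s + i + 1 + 1),
      increment (logGrowth p lam) j / (p : ℝ) ^ j =
      -Real.log r - D / ((p : ℝ) ^ (s + i + 1) * (p - 1)) := by
    intro i
    rw [sum_increment_logGrowth_div_pow p lam (by omega), add_assoc s i 1,
      sum_increment_div_pow hp hlow hhigh, hlogr]
    ring
  constructor
  · intro n
    rw [← Real.log_nonpos_iff (by have := hW n; positivity), hlog]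
    have hn : n < p ^ (s + n + 1 + 1) :=
      (Nat.lt_pow_self hp.one_lt).trans_le (Nat.pow_le_pow_right hp.pos (by omega))
    rw [sum_padicValNat_eq_sum_increment hp _ _ n hn]
    have hle : ∑ i ∈ Finset.range (s + n + 1 + 1),
        increment (logGrowth p lam) i * ((n / p ^ i : ℕ) : ℝ) ≤
        ∑ i ∈ Finset.range (s + n + 1 + 1), n * (increment (logGrowth p lam) i / (p : ℝ) ^ i) := by
      refine Finset.sum_le_sum fun i _ => ?_
      have h1 : ((n / p ^ i : ℕ) : ℝ) ≤ n / (p : ℝ) ^ i := by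
        simpa using (Nat.cast_div_le (α := ℝ) (m := n) (n := p ^ i))
      calc _ ≤ increment (logGrowth p lam) i * (n / (p : ℝ) ^ i) :=
            mul_le_mul_of_nonneg_left h1 (increment_logGrowth_nonneg hpn hp hroot hlam i)
        _ = _ := by ring
    rw [← Finset.mul_sum, hsum] at hle
    have hnn : 0 ≤ (n : ℝ) * (D / ((p : ℝ) ^ (s + n + 1) * (p - 1))) := by positivity
    linarith
  · intro i
    have hpos : 0 < conjugacyNorm p lam (p ^ (s + i + 1)) * r ^ p ^ (s + i + 1) :=
      mul_pos (hW _) (by positivity)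
    rw [← Real.exp_log hpos, hlog, sum_padicValNat_eq_sum_increment hp _ (s + i + 1 + 1) _
      (Nat.pow_lt_pow_right hp.one_lt (Nat.lt_succ_self _))]
    have heq : ∑ j ∈ Finset.range (s + i + 1 + 1),
        increment (logGrowth p lam) j * ((p ^ (s + i + 1) / p ^ j : ℕ) : ℝ) =
        ∑ j ∈ Finset.range (s + i + 1 + 1),
          (p : ℝ) ^ (s + i + 1) * (increment (logGrowth p lam) j / (p : ℝ) ^ j) := by
      refine Finset.sum_congr rfl fun j hj => ?_
      rw [Finset.mem_range] at hj
      rw [Nat.cast_div (pow_dvd_pow p (by omega)) (by push_cast; positivity)]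
      push_cast
      ring
    rw [heq, ← Finset.mul_sum, hsum]
    congr 1
    push_cast
    field_simp
    ring

end ConjugacyNormGrowth

theorem rQuad_pos {p : ℕ} {K : Type*} [NontriviallyNormedField K] {lam γ₀ : K} {s t : ℕ}
    (hp : p.Prime) (hroot : ∀ n : ℕ, 1 ≤ n → lam ^ n ≠ 1)
    (hγ₀ : γ₀ ∈ GammaR p K) :
    0 < rQuad p lam γ₀ 1 s t := by
  have hR := Rr_succ_pos hp.pos s
  have hp0 : (0 : ℝ) < p := by exact_mod_cast hp.pos
  have h1 := norm_one_sub_pow_pos hroot (le_refl 1)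
  have h2 : 0 < ‖γ₀ - lam ^ 1‖ := by
    rw [norm_pos_iff, sub_ne_zero, pow_one]
    rintro rfl
    obtain ⟨k, hk⟩ := hγ₀
    exact hroot _ (pow_pos hp.pos k) hk
  unfold rQuad rTilde
  have h1' := h1
  rw [pow_one] at h1'
  positivity

section QuadraticRadius

variable {K : Type*} [NontriviallyNormedField K] [IsUltrametricDist K] [IsAlgClosed K]
  {p : ℕ} {lam γ₀ : K} {s t : ℕ}

theorem negLogNorm_of_lt (hp : p.Prime) (hpn : ‖(p : K)‖ = (p : ℝ)⁻¹)
    (hs : Rr p s ≤ ‖1 - lam‖) {i : ℕ} (hi : i < s) :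
    negLogNorm p lam i = (p : ℝ) ^ i * negLogNorm p lam 0 := by
  have h : ‖1 - lam ^ p ^ i‖ = ‖1 - lam‖ ^ p ^ i := by
    refine norm_one_sub_pow_of_forall_root hp hpn fun z hz => ?_
    have hlt : ‖1 - z‖ < ‖1 - lam‖ :=
      (norm_one_sub_root_le_Rr hp hpn hz).trans_lt ((Rr_strictMono hp hi).trans_le hs)
    have := norm_sub_eq_right_of_norm_lt hlt
    rwa [sub_sub_sub_cancel_left] at this
  rw [negLogNorm, h, Real.log_pow, negLogNorm]
  push_cast
  simp

theorem negLogNorm_add (hp : p.Prime) (hpn : ‖(p : K)‖ = (p : ℝ)⁻¹)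
    (hroot : ∀ n : ℕ, 1 ≤ n → lam ^ n ≠ 1) (hs : ‖1 - lam‖ < Rr p (s + 1)) (i : ℕ) :
    negLogNorm p lam (s + i) = negLogNorm p lam s + i * Real.log p := by
  have hp0 : (p : ℝ) ≠ 0 := by exact_mod_cast hp.ne_zero
  rw [negLogNorm, norm_one_sub_pow_add_of_lt_Rr hp hpn hs, Real.log_mul (by positivity)
    (norm_one_sub_pow_pos hroot (pow_pos hp.pos s)).ne', Real.log_pow, Real.log_inv, negLogNorm]
  ring

theorem norm_one_sub_pow_eq_of_nearest_root (hp : p.Prime) (hpn : ‖(p : K)‖ = (p : ℝ)⁻¹)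
    (hs : ‖1 - lam‖ < Rr p (s + 1)) (hγ₀ : γ₀ ∈ GammaR p K)
    (hγmin : ∀ γ ∈ GammaR p K, ‖γ₀ - lam‖ ≤ ‖γ - lam‖)
    (ht : Rr p t ≤ ‖γ₀ - lam‖ ∧ ‖γ₀ - lam‖ < Rr p (t + 1)) :
    t ≤ s ∧ ‖1 - lam ^ p ^ s‖ = (p : ℝ)⁻¹ ^ (s - t) * ‖γ₀ - lam‖ ^ p ^ t := by
  have hone : ‖γ₀ - lam‖ ≤ ‖1 - lam‖ := hγmin 1 ⟨0, by simp⟩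
  have hts : t ≤ s := Nat.lt_succ_iff.1
    ((Rr_strictMono hp).lt_iff_lt.1 (ht.1.trans_lt (hone.trans_lt hs)))
  have hγs : γ₀ ^ p ^ s = 1 := by
    refine pow_eq_one_of_norm_one_sub_lt_Rr hp hpn hγ₀ (lt_of_le_of_lt ?_ hs)
    have h := norm_sub_le_max' (1 - lam) (γ₀ - lam)
    rw [sub_sub_sub_cancel_right] at h
    exact h.trans (max_le le_rfl hone)
  have hγ1 : ‖γ₀‖ = 1 := IsOfFinOrder.norm_eq_one
    (isOfFinOrder_iff_pow_eq_one.2 ⟨_, pow_pos hp.pos s, hγs⟩)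
  have hγ0 : γ₀ ≠ 0 := norm_ne_zero_iff.1 (by rw [hγ1]; exact one_ne_zero)
  have hdist : ∀ z : K, ‖z - lam / γ₀‖ = ‖z * γ₀ - lam‖ := by
    intro z
    rw [← mul_one ‖z - lam / γ₀‖, ← hγ1, ← norm_mul, sub_mul, div_mul_cancel₀ _ hγ0]
  have hx : ‖1 - lam / γ₀‖ = ‖γ₀ - lam‖ := by rw [hdist, one_mul]
  have hpow : (lam / γ₀) ^ p ^ s = lam ^ p ^ s := by rw [div_pow, hγs, div_one]
  refine ⟨hts, ?_⟩
  have h := norm_one_sub_pow_add_of_lt_Rr hp hpn (hx.symm ▸ ht.2) (s - t)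
  rw [Nat.add_sub_cancel' hts, hpow] at h
  rw [h]
  congr 1
  refine norm_one_sub_pow_of_forall_root hp hpn fun z hz => ?_
  rw [norm_sub_rev]
  refine le_antisymm ?_ ?_
  · have h2 := norm_sub_le_max' (1 - lam / γ₀) (1 - z)
    rw [sub_sub_sub_cancel_left, hx] at h2
    exact h2.trans (max_le le_rfl ((norm_one_sub_root_le_Rr hp hpn hz).trans ht.1))
  · rw [hdist]
    obtain ⟨k, hk⟩ := hγ₀
    exact hγmin _ ⟨t + k, by
      rw [mul_pow, pow_add, pow_mul, hz, one_pow, mul_comm (p ^ t), pow_mul, hk, one_pow, one_mul]⟩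

theorem neg_log_rQuad (hp : p.Prime) (hpn : ‖(p : K)‖ = (p : ℝ)⁻¹)
    (hroot : ∀ n : ℕ, 1 ≤ n → lam ^ n ≠ 1)
    (hs : ‖1 - lam‖ < Rr p (s + 1)) (hγ₀ : γ₀ ∈ GammaR p K)
    (hγmin : ∀ γ ∈ GammaR p K, ‖γ₀ - lam‖ ≤ ‖γ - lam‖)
    (ht : Rr p t ≤ ‖γ₀ - lam‖ ∧ ‖γ₀ - lam‖ < Rr p (t + 1)) :
    -Real.log (rQuad p lam γ₀ 1 s t) = negLogNorm p lam 0 * (s * ((p - 1) / p)) +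
      negLogNorm p lam s / (p : ℝ) ^ s + Real.log p / ((p : ℝ) ^ s * (p - 1)) -
        negLogNorm p lam 0 / p := by
  obtain ⟨hts, hes⟩ := norm_one_sub_pow_eq_of_nearest_root hp hpn hs hγ₀ hγmin ht
  have hR := Rr_succ_pos hp.pos s
  have hp0 : (0 : ℝ) < p := by exact_mod_cast hp.pos
  have hp1 : (0 : ℝ) < (p : ℝ) - 1 := by
    have : (1 : ℝ) < p := by exact_mod_cast hp.one_lt
    linarith
  have h1 : 0 < ‖1 - lam‖ := by simpa using norm_one_sub_pow_pos hroot (le_refl 1)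
  have h2 : 0 < ‖γ₀ - lam‖ := by
    rw [norm_pos_iff, sub_ne_zero]
    rintro rfl
    obtain ⟨k, hk⟩ := hγ₀
    exact hroot _ (pow_pos hp.pos k) hk
  have hlogR : Real.log (Rr p (s + 1)) = -(Real.log p / ((p : ℝ) ^ s * (p - 1))) := by
    rw [Rr, if_neg (Nat.succ_ne_zero s), Real.log_rpow hp0, Nat.add_sub_cancel]
    ring
  have hrp : (p : ℝ) ^ ((s : ℝ) - (t : ℝ)) = (p : ℝ) ^ s / (p : ℝ) ^ t := by
    rw [Real.rpow_sub hp0, Real.rpow_natCast, Real.rpow_natCast]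
  have hV : negLogNorm p lam s =
      ((s : ℝ) - t) * Real.log p - (p : ℝ) ^ t * Real.log ‖γ₀ - lam‖ := by
    rw [negLogNorm, hes, Real.log_mul (by positivity) (by positivity), Real.log_pow, Real.log_pow,
      Real.log_inv, Nat.cast_sub hts]
    push_cast
    ring
  have hV0 : negLogNorm p lam 0 = -Real.log ‖1 - lam‖ := by simp [negLogNorm]
  rw [hV, hV0, rQuad, rTilde, hrp]
  simp only [pow_one, Nat.cast_one, one_mul, div_one, Real.rpow_one]
  rw [Real.log_mul (by positivity) (by positivity), Real.log_mul (by positivity) (by positivity),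
    Real.log_mul (by positivity) (by positivity), Real.log_mul (by positivity) (by positivity),
    Real.log_rpow h1, Real.log_rpow h1, Real.log_rpow hp0, Real.log_rpow h2, hlogR]
  field_simp
  ring

end QuadraticRadius

section PowerSeriesEvaluation

variable {K : Type*} [NontriviallyNormedField K]

theorem eq_zero_of_eventually_hasSum_zero {d : ℕ → K}
    (h : ∀ᶠ x in nhds (0 : K), HasSum (fun k => d k * x ^ k) 0) (k : ℕ) : d k = 0 := by
  have hps : HasFPowerSeriesAt (0 : K → K) (FormalMultilinearSeries.ofScalars K d) 0 := by
    rw [hasFPowerSeriesAt_iff]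
    filter_upwards [h] with x hx
    simpa [FormalMultilinearSeries.coeff_ofScalars, mul_comm] using hx
  have h0 := hps.eq_zero
  have hcoeff : (FormalMultilinearSeries.ofScalars K d).coeff k = d k :=
    FormalMultilinearSeries.coeff_ofScalars
  rw [← hcoeff, h0]
  rfl

theorem summable_of_norm_mul_pow_le [CompleteSpace K] {b : ℕ → K} (hb0 : b 0 = 0) {r : ℝ} (hr : 0 < r)
    (hb : ∀ n, ‖b (n + 1)‖ * r ^ n ≤ 1) {x : K} (hx : ‖x‖ < r) :
    Summable fun k => b k * x ^ k := by
  refine Summable.of_norm_bounded (g := fun k => r * (‖x‖ / r) ^ k)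
    ((summable_geometric_of_lt_one (by positivity) ((div_lt_one hr).2 hx)).mul_left r) fun k => ?_
  rcases k with _ | n
  · simpa [hb0] using hr.le
  · rw [norm_mul, norm_pow]
    calc ‖b (n + 1)‖ * ‖x‖ ^ (n + 1) = ‖b (n + 1)‖ * r ^ n * (r * (‖x‖ / r) ^ (n + 1)) := by
          rw [div_pow]
          field_simp
          ring
      _ ≤ r * (‖x‖ / r) ^ (n + 1) := mul_le_of_le_one_left (by positivity) (hb n)

variable [IsUltrametricDist K]

theorem norm_pow_succ_sub_pow_succ_le {x y : K} {σ : ℝ} (hx : ‖x‖ ≤ σ) (hy : ‖y‖ ≤ σ) (n : ℕ) :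
    ‖x ^ (n + 1) - y ^ (n + 1)‖ ≤ ‖x - y‖ * σ ^ n := by
  have hσ : 0 ≤ σ := (norm_nonneg x).trans hx
  induction n with
  | zero => simp
  | succ n ih =>
    have h : x ^ (n + 1 + 1) - y ^ (n + 1 + 1) =
        x * (x ^ (n + 1) - y ^ (n + 1)) + (x - y) * y ^ (n + 1) := by ring
    rw [h]
    refine (IsUltrametricDist.norm_add_le_max _ _).trans (max_le ?_ ?_)
    · rw [norm_mul]
      calc ‖x‖ * ‖x ^ (n + 1) - y ^ (n + 1)‖ ≤ σ * (‖x - y‖ * σ ^ n) := by gcongr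
        _ = ‖x - y‖ * σ ^ (n + 1) := by ring
    · rw [norm_mul, norm_pow]
      gcongr

theorem norm_pEval_le {c : ℕ → K} (hc0 : c 0 = 0) (hc : ∀ i, ‖c i‖ ≤ 1) {x : K}
    (hx : ‖x‖ ≤ 1) : ‖pEval c x‖ ≤ ‖x‖ := by
  refine IsUltrametricDist.norm_tsum_le_of_forall_le fun k => ?_
  rcases k with _ | k
  · simp [hc0]
  · rw [norm_mul, norm_pow, pow_succ]
    calc ‖c (k + 1)‖ * (‖x‖ ^ k * ‖x‖) ≤ 1 * (1 * ‖x‖) := by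
          gcongr
          · exact hc _
          · exact pow_le_one₀ (norm_nonneg _) hx
      _ = ‖x‖ := by ring

variable [CompleteSpace K]

theorem hasSum_coeff_mk_pow {c : ℕ → K} (hc : ∀ i, ‖c i‖ ≤ 1) {x : K} (hx : ‖x‖ < 1) (l : ℕ) :
    HasSum (fun k => PowerSeries.coeff k (PowerSeries.mk c ^ l) * x ^ k) (pEval c x ^ l) := by
  have hnorm : ∀ l, Summable fun k =>
      ‖PowerSeries.coeff k (PowerSeries.mk c ^ l) * x ^ k‖ := fun l =>
    Summable.of_nonneg_of_le (fun _ => norm_nonneg _) (fun k => by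
      rw [norm_mul, norm_pow]
      exact mul_le_of_le_one_left (by positivity) (norm_coeff_mk_pow_le_one hc k l))
      (summable_geometric_of_lt_one (norm_nonneg x) hx)
  rw [(hnorm l).of_norm.hasSum_iff]
  induction l with
  | zero =>
    rw [tsum_eq_single 0]
    · simp
    · intro k hk
      simp [PowerSeries.coeff_one, hk]
  | succ l ih =>
    have h1 : pEval c x = ∑' k, PowerSeries.coeff k (PowerSeries.mk c ^ 1) * x ^ k := by
      simp [pEval]
    rw [pow_succ (pEval c x), ← ih, h1,
      tsum_mul_tsum_eq_tsum_sum_antidiagonal_of_summable_norm (hnorm l) (hnorm 1)]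
    refine tsum_congr fun k => ?_
    rw [pow_succ, PowerSeries.coeff_mul, Finset.sum_mul]
    refine Finset.sum_congr rfl fun ij hij => ?_
    rw [← Finset.HasAntidiagonal.mem_antidiagonal.1 hij, pow_one, pow_add]
    ring

theorem hasSum_compCoeff {b c : ℕ → K} (hc0 : c 0 = 0) (hc : ∀ i, ‖c i‖ ≤ 1) {C ρ : ℝ}
    (hρ : 0 < ρ) (hρ1 : ρ ≤ 1) (hb : ∀ l, ‖b l‖ * ρ ^ l ≤ C) {x : K} (hx : ‖x‖ < ρ) :
    HasSum (fun k => compCoeff b c k * x ^ k) (pEval b (pEval c x)) := by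
  set F : ℕ × ℕ → K := fun kl =>
    b kl.2 * (PowerSeries.coeff kl.1 (PowerSeries.mk c ^ kl.2) * x ^ kl.1) with hF
  have hC : 0 ≤ C := (by positivity : 0 ≤ ‖b 0‖ * ρ ^ 0).trans (hb 0)
  have hzero : ∀ k l, k < l → F (k, l) = 0 := fun k l h => by
    simp [hF, coeff_mk_pow_eq_zero_of_lt hc0 h]
  have hbound : ∀ k l, l ≤ k → ‖F (k, l)‖ ≤ C * (‖x‖ / ρ) ^ k := by
    intro k l hlk
    have h1 : ‖b l‖ * ρ ^ k ≤ C :=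
      (mul_le_mul_of_nonneg_left (pow_le_pow_of_le_one hρ.le hρ1 hlk) (norm_nonneg _)).trans (hb l)
    calc ‖F (k, l)‖ ≤ ‖b l‖ * (1 * ‖x‖ ^ k) := by
          simp only [hF, norm_mul, norm_pow]
          gcongr
          exact norm_coeff_mk_pow_le_one hc k l
      _ = ‖b l‖ * ρ ^ k * (‖x‖ / ρ) ^ k := by
          rw [div_pow]
          field_simp
      _ ≤ C * (‖x‖ / ρ) ^ k := by gcongr
  have hlim : Filter.Tendsto (fun k => C * (‖x‖ / ρ) ^ k) Filter.atTop (nhds 0) := by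
    simpa using (tendsto_pow_atTop_nhds_zero_of_lt_one (by positivity)
      ((div_lt_one hρ).2 hx)).const_mul C
  have hsum : Summable F := by
    refine NonarchimedeanAddGroup.summable_of_tendsto_cofinite_zero ?_
    rw [Metric.tendsto_nhds]
    intro ε hε
    obtain ⟨N, hN⟩ := Filter.eventually_atTop.1 (hlim.eventually (gt_mem_nhds hε))
    rw [Filter.eventually_cofinite]
    refine (Finset.finite_toSet (Finset.range N ×ˢ Finset.range N)).subset ?_
    rintro ⟨k, l⟩ hkl
    rw [Set.mem_ofPred_eq, dist_zero_right] at hkl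
    have hlk : l ≤ k := by
      by_contra! h
      exact hkl (by simpa [hzero k l h] using hε)
    have hkN : k < N := by
      by_contra! h
      exact hkl ((hbound k l hlk).trans_lt (hN k h))
    simp only [Finset.coe_product, Finset.coe_range, Set.mem_prod, Set.mem_Iio]
    omega
  have hk : HasSum (fun k => compCoeff b c k * x ^ k) (∑' kl, F kl) := by
    refine hsum.hasSum.prod_fiberwise fun k => ?_
    rw [compCoeff, Finset.sum_mul]
    simp only [mul_assoc]
    exact hasSum_sum_of_ne_finset_zero fun l hl => hzero k l (by simpa using hl)
  have hl : HasSum (fun l => b l * pEval c x ^ l) (∑' kl, F kl) := by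
    have hswap : HasSum (F ∘ Prod.swap) (∑' kl, F kl) :=
      (Equiv.prodComm ℕ ℕ).hasSum_iff.2 hsum.hasSum
    exact hswap.prod_fiberwise fun l =>
      (hasSum_coeff_mk_pow hc (hx.trans_le hρ1) l).mul_left (b l)
  rwa [pEval, hl.tsum_eq]

theorem norm_pEval_sub_sub_le {b : ℕ → K} (hb0 : b 0 = 0) (hb1 : b 1 = 1) {r : ℝ} (hr : 0 < r)
    (hb : ∀ n, ‖b (n + 1)‖ * r ^ n ≤ 1) {σ : ℝ} (hσ : σ < r) {x y : K} (hx : ‖x‖ ≤ σ)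
    (hy : ‖y‖ ≤ σ) : ‖pEval b x - pEval b y - (x - y)‖ ≤ σ / r * ‖x - y‖ := by
  have hσ0 : 0 ≤ σ := (norm_nonneg x).trans hx
  have hsx := (summable_of_norm_mul_pow_le hb0 hr hb (hx.trans_lt hσ)).hasSum
  have hsy := (summable_of_norm_mul_pow_le hb0 hr hb (hy.trans_lt hσ)).hasSum
  have hsum := (hsx.sub hsy).sub (hasSum_ite_eq 1 (x - y))
  rw [pEval, pEval, ← hsum.tsum_eq]
  refine IsUltrametricDist.norm_tsum_le_of_forall_le fun k => ?_
  have hnn : 0 ≤ σ / r * ‖x - y‖ := by positivity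
  rcases k with _ | _ | n
  · simpa [hb0] using hnn
  · simpa [hb1] using hnn
  · rw [if_neg (by omega), sub_zero, ← mul_sub, norm_mul]
    calc ‖b (n + 1 + 1)‖ * ‖x ^ (n + 1 + 1) - y ^ (n + 1 + 1)‖
        ≤ ‖b (n + 1 + 1)‖ * (‖x - y‖ * σ ^ (n + 1)) := by
          gcongr
          exact norm_pow_succ_sub_pow_succ_le hx hy (n + 1)
      _ = ‖b (n + 1 + 1)‖ * r ^ (n + 1) * ((σ / r) ^ (n + 1) * ‖x - y‖) := by
          rw [div_pow]
          field_simp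
      _ ≤ 1 * ((σ / r) ^ 1 * ‖x - y‖) := by
          refine mul_le_mul (hb (n + 1)) ?_ (by positivity) zero_le_one
          refine mul_le_mul_of_nonneg_right ?_ (norm_nonneg _)
          exact pow_le_pow_of_le_one (by positivity) ((div_lt_one hr).2 hσ).le (by omega)
      _ = σ / r * ‖x - y‖ := by ring

theorem bijOn_pEval_ball {b : ℕ → K} (hb0 : b 0 = 0) (hb1 : b 1 = 1) {r : ℝ} (hr : 0 < r)
    (hb : ∀ n, ‖b (n + 1)‖ * r ^ n ≤ 1) :
    Set.BijOn (pEval b) (Metric.ball 0 r) (Metric.ball 0 r) := by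
  have hzero : pEval b 0 = 0 := by
    rw [pEval, tsum_eq_single 0]
    · simp [hb0]
    · intro k hk; simp [hk]
  have hself : ∀ {σ : ℝ} {x : K}, σ < r → ‖x‖ ≤ σ → ‖pEval b x - x‖ ≤ ‖x‖ := by
    intro σ x hσ hx
    have hσ0 : 0 ≤ σ := (norm_nonneg x).trans hx
    have h := norm_pEval_sub_sub_le hb0 hb1 hr hb hσ hx (y := 0) (by simpa using hσ0)
    rw [hzero, sub_zero, sub_zero] at h
    exact h.trans (mul_le_of_le_one_left (norm_nonneg _) ((div_lt_one hr).2 hσ).le)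
  refine ⟨fun x hx => ?_, fun x hx y hy hxy => ?_, fun y hy => ?_⟩
  · rw [mem_ball_zero_iff] at hx ⊢
    have h := IsUltrametricDist.norm_add_le_max (pEval b x - x) x
    rw [sub_add_cancel] at h
    exact (h.trans (max_le (hself hx le_rfl) le_rfl)).trans_lt hx
  · rw [mem_ball_zero_iff] at hx hy
    have hσ := max_lt hx hy
    have h := norm_pEval_sub_sub_le hb0 hb1 hr hb hσ (le_max_left _ _) (le_max_right _ _)
    rw [hxy, sub_self, zero_sub, norm_neg] at h
    by_contra hne
    have hpos : 0 < ‖x - y‖ := norm_pos_iff.2 (sub_ne_zero.2 hne)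
    have : max ‖x‖ ‖y‖ / r * ‖x - y‖ < 1 * ‖x - y‖ :=
      mul_lt_mul_of_pos_right ((div_lt_one hr).2 hσ) hpos
    linarith
  · rw [mem_ball_zero_iff] at hy
    set φ : K → K := fun x => y - (pEval b x - x) with hφ
    have hmaps : Set.MapsTo φ (Metric.closedBall 0 ‖y‖) (Metric.closedBall 0 ‖y‖) := by
      intro x hx
      rw [mem_closedBall_zero_iff] at hx ⊢
      exact (norm_sub_le_max' _ _).trans (max_le le_rfl ((hself hy hx).trans hx))
    have hcontr : ContractingWith (Real.toNNReal (‖y‖ / r)) (hmaps.restrict φ _ _) := by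
      refine ⟨by rw [Real.toNNReal_lt_one]; exact (div_lt_one hr).2 hy, ?_⟩
      refine LipschitzWith.of_dist_le_mul fun u v => ?_
      rw [Real.coe_toNNReal _ (by positivity), Subtype.dist_eq, Subtype.dist_eq, dist_eq_norm,
        dist_eq_norm]
      have h := norm_pEval_sub_sub_le hb0 hb1 hr hb hy (mem_closedBall_zero_iff.1 u.2)
        (mem_closedBall_zero_iff.1 v.2)
      rw [← norm_neg] at h
      have hφuv : φ u - φ v = -(pEval b u - pEval b v - (u - v)) := by
        simp only [hφ]
        ring
      rwa [← hφuv] at h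
    obtain ⟨x, hx, hfix, -⟩ := hcontr.exists_fixedPoint' Metric.isClosed_closedBall.isComplete
      hmaps (x := 0) (by simp) (edist_ne_top _ _)
    refine ⟨x, ?_, ?_⟩
    · rw [mem_closedBall_zero_iff] at hx
      rw [mem_ball_zero_iff]
      exact hx.trans_lt hy
    · have h : y - (pEval b x - x) = x := hfix
      linear_combination -h

end PowerSeriesEvaluation

section Linearization

variable {K : Type*} [NontriviallyNormedField K] [IsUltrametricDist K] [CompleteSpace K]
  {lam : K} {c : ℕ → K}

theorem IsConjugacy.linearizableOn_ball {b : ℕ → K} (hb : IsConjugacy lam c b) (hc0 : c 0 = 0)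
    (hc : ∀ i, ‖c i‖ ≤ 1) {r : ℝ} (hr : 0 < r) (hr1 : r ≤ 1)
    (hbr : ∀ n, ‖b (n + 1)‖ * r ^ n ≤ 1) :
    LinearizableOn (pEval c) lam (Metric.ball 0 r) := by
  have hbC : ∀ l, ‖b l‖ * r ^ l ≤ r := by
    intro l
    rcases l with _ | n
    · simpa [hb.1] using hr.le
    · rw [pow_succ, ← mul_assoc]
      exact mul_le_of_le_one_left hr.le (hbr n)
  refine ⟨fun x hx => ?_, b, hb.1, hb.2.1, fun x hx => ?_,
    bijOn_pEval_ball hb.1 hb.2.1 hr hbr, fun x hx => ?_⟩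
  · rw [mem_ball_zero_iff] at hx ⊢
    exact (norm_pEval_le hc0 hc (hx.le.trans hr1)).trans_lt hx
  · exact summable_of_norm_mul_pow_le hb.1 hr hbr (mem_ball_zero_iff.1 hx)
  · rw [← (hasSum_compCoeff hc0 hc hr hr1 hbC (mem_ball_zero_iff.1 hx)).tsum_eq, pEval,
      ← tsum_mul_left]
    exact tsum_congr fun k => by rw [hb.2.2 k, mul_assoc]

theorem LinearizableOn.exists_isConjugacy {U : Set K} (hU : IsZeroDisk U)
    (hlin : LinearizableOn (pEval c) lam U) (hc0 : c 0 = 0) (hc : ∀ i, ‖c i‖ ≤ 1) {x₀ : K}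
    (hx₀ : x₀ ∈ U) (hne : x₀ ≠ 0) :
    ∃ b, IsConjugacy lam c b ∧ Summable fun k => b k * x₀ ^ k := by
  obtain ⟨-, b, hb0, hb1, hsum, -, hconj⟩ := hlin
  refine ⟨b, ⟨hb0, hb1, fun k => sub_eq_zero.1 ?_⟩, hsum x₀ hx₀⟩
  have hpos : 0 < ‖x₀‖ := norm_pos_iff.2 hne
  obtain ⟨C, hC⟩ := (hsum x₀ hx₀).tendsto_atTop_zero.norm.bddAbove_range
  set ρ := min 1 ‖x₀‖ with hρ
  have hρpos : 0 < ρ := lt_min one_pos hpos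
  have hbC : ∀ l, ‖b l‖ * ρ ^ l ≤ C := fun l => by
    have h : ‖b l * x₀ ^ l‖ ≤ C := hC ⟨l, rfl⟩
    rw [norm_mul, norm_pow] at h
    refine le_trans ?_ h
    gcongr
    exact min_le_right _ _
  refine eq_zero_of_eventually_hasSum_zero (d := fun k => compCoeff b c k - lam * b k) ?_ k
  filter_upwards [Metric.ball_mem_nhds (0 : K) hρpos] with x hx
  rw [mem_ball_zero_iff] at hx
  have hxx₀ : ‖x‖ < ‖x₀‖ := hx.trans_le (min_le_right _ _)
  have hxU : x ∈ U := by
    obtain ⟨R, rfl | rfl⟩ := hU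
    · rw [mem_ball_zero_iff] at hx₀ ⊢
      exact hxx₀.trans hx₀
    · rw [mem_closedBall_zero_iff] at hx₀ ⊢
      exact hxx₀.le.trans hx₀
  have h := (hasSum_compCoeff hc0 hc hρpos (min_le_left _ _) hbC hx).sub
    ((hsum x hxU).hasSum.mul_left lam)
  rw [hconj x hxU, ← pEval, sub_self] at h
  simpa only [sub_mul, mul_assoc] using h

end Linearization

section Corollary

variable {p : ℕ} {K : Type*} [NontriviallyNormedField K] [IsUltrametricDist K] [CompleteSpace K]
  [IsAlgClosed K] {lam γ₀ : K} {s t : ℕ} {c : ℕ → K}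

theorem linearizableOn_ball_rQuad_and_maximal (hp : p.Prime) (hp3 : 3 ≤ p)
    (hpn : ‖(p : K)‖ = (p : ℝ)⁻¹) (hroot : ∀ n : ℕ, 1 ≤ n → lam ^ n ≠ 1)
    (hlam1 : ‖(p : K)‖ < ‖1 - lam‖) (hlam2 : ‖1 - lam‖ < 1)
    (hs : Rr p s ≤ ‖1 - lam‖ ∧ ‖1 - lam‖ < Rr p (s + 1)) (hγ₀ : γ₀ ∈ GammaR p K)
    (hγmin : ∀ γ ∈ GammaR p K, ‖γ₀ - lam‖ ≤ ‖γ - lam‖)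
    (ht : Rr p t ≤ ‖γ₀ - lam‖ ∧ ‖γ₀ - lam‖ < Rr p (t + 1))
    (hc0 : c 0 = 0) (hc1 : c 1 = lam) (hc : ∀ i, ‖c i‖ ≤ 1)
    (hc2 : ‖c 2‖ = 1) (hc3 : ‖c 2 ^ 2 - c 3‖ = 1) :
    LinearizableOn (pEval c) lam (Metric.ball (0 : K) (rQuad p lam γ₀ 1 s t)) ∧
      ∀ U : Set K, IsZeroDisk U → LinearizableOn (pEval c) lam U →
        U ⊆ Metric.ball (0 : K) (rQuad p lam γ₀ 1 s t) := by
  have hr : 0 < rQuad p lam γ₀ 1 s t := rQuad_pos hp hroot hγ₀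
  obtain ⟨hle, heq⟩ := conjugacyNorm_growth hp hlam1.le hroot hlam2
    (Real.log_nonneg (by exact_mod_cast hp.one_lt.le))
    (fun i hi => negLogNorm_of_lt hp hpn hs.1 hi) (fun i => negLogNorm_add hp hpn hroot hs.2 i) hr
    (neg_log_rQuad hp hpn hroot hs.2 hγ₀ hγmin ht)
  set r := rQuad p lam γ₀ 1 s t
  have hnorm : ∀ {b : ℕ → K}, IsConjugacy lam c b → ∀ n, ‖b (n + 1)‖ = conjugacyNorm p lam n :=
    fun hb n => hb.norm_eq hp hp3 hroot hlam1 hlam2 hc0 hc1 hc hc2 hc3 n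
  constructor
  · have hlam0 : lam ≠ 0 := by
      rintro rfl
      simp at hlam2
    have hb := isConjugacy_conjugacyCoeff hlam0 hroot hc0 hc1
    have hr1 : r ≤ 1 := by
      have h1 : 1 < conjugacyNorm p lam 1 := by
        have h := conjugacyNorm_strictMono hlam1.le hroot hlam2 zero_lt_one
        simpa [conjugacyNorm] using h
      have h2 := hle 1
      rw [pow_one] at h2
      exact (le_mul_of_one_le_left hr.le h1.le).trans h2
    exact hb.linearizableOn_ball hc0 hc hr hr1 fun n => by
      rw [hnorm hb]
      exact hle n
  · intro U hU hlin x₀ hx₀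
    rw [mem_ball_zero_iff]
    by_contra! hrx
    obtain ⟨b, hb, hsum⟩ := hlin.exists_isConjugacy hU hc0 hc hx₀
      (norm_pos_iff.1 (hr.trans_le hrx))
    have hindex : Filter.Tendsto (fun i => p ^ (s + i + 1) + 1) Filter.atTop Filter.atTop :=
      Filter.tendsto_atTop_mono (fun i => (show i ≤ s + i + 1 by omega).trans
        ((Nat.lt_pow_self hp.one_lt).le.trans (Nat.le_succ _))) Filter.tendsto_id
    have hlim := (hsum.tendsto_atTop_zero.norm).comp hindex
    rw [norm_zero] at hlim
    have hpos : 0 < Real.exp (-(Real.log p / (p - 1))) * r := by positivity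
    refine hpos.not_ge (ge_of_tendsto' hlim fun i => ?_)
    rw [Function.comp_apply, norm_mul, norm_pow, hnorm hb, ← heq i, mul_assoc, ← pow_succ]
    have := (conjugacyNorm_pos (p := p) hroot (p ^ (s + i + 1))).le
    gcongr

end Corollary

theorem pEval_quadCoeff {K : Type*} [NontriviallyNormedField K] (lam : K) :
    pEval (quadCoeff lam) = fun x => lam * x + x ^ 2 := by
  funext x
  rw [pEval, tsum_eq_sum (s := Finset.range 3)]
  · simp [Finset.sum_range_succ, quadCoeff]
  · intro k hk
    have hk3 : 3 ≤ k := by simpa using hk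
    simp [quadCoeff, show k ≠ 1 by omega, show k ≠ 2 by omega]

/-- Corollary B: invariance of the quadratic linearization radius under
power series perturbations. For `p ≥ 3`, `1/p < |1-λ| < 1`, and
`f(x) = λx + Σ_{i≥2} aᵢxⁱ ∈ 𝒪_p[[x]]` with `|a₂| = 1` and `|a₂² - a₃| = 1`, the
linearization disk of `f` is exactly the open disk of radius
`r(f) = |1-λ|^{-1/p}·r̃(λ)`, which is also exactly the linearization disk of
`P_λ(x) = λx + x²`. -/
theorem stmt2 (p : ℕ) [Fact p.Prime] (hp3 : 3 ≤ p)
    {K : Type*} [NontriviallyNormedField K] [IsUltrametricDist K] [CompleteSpace K]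
    [IsAlgClosed K] [Algebra ℚ_[p] K]
    (hiso : ∀ x : ℚ_[p], ‖algebraMap ℚ_[p] K x‖ = ‖x‖)
    (hdense : Dense {x : K | IsAlgebraic ℚ_[p] x})
    (lam : K) (hroot : ∀ n : ℕ, 1 ≤ n → lam ^ n ≠ 1)
    (hlam1 : 1 / (p : ℝ) < ‖1 - lam‖) (hlam2 : ‖1 - lam‖ < 1)
    (m : ℕ) (hm : IsLeast {n : ℕ | 1 ≤ n ∧ ‖1 - lam ^ n‖ < 1} m)
    (s : ℕ) (hs : Rr p s ≤ ‖1 - lam ^ m‖ ∧ ‖1 - lam ^ m‖ < Rr p (s + 1))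
    (γ₀ : K) (hγ₀ : γ₀ ∈ GammaR p K)
    (hγmin : ∀ γ ∈ GammaR p K, ‖γ₀ - lam ^ m‖ ≤ ‖γ - lam ^ m‖)
    (t : ℕ) (ht : Rr p t ≤ ‖γ₀ - lam ^ m‖ ∧ ‖γ₀ - lam ^ m‖ < Rr p (t + 1))
    (c : ℕ → K) (hc0 : c 0 = 0) (hc1 : c 1 = lam) (hc : ∀ i, ‖c i‖ ≤ 1)
    (hc2 : ‖c 2‖ = 1) (hc3 : ‖c 2 ^ 2 - c 3‖ = 1) :
    (LinearizableOn (pEval c) lam (Metric.ball (0 : K) (rQuad p lam γ₀ m s t)) ∧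
      ∀ U : Set K, IsZeroDisk U → LinearizableOn (pEval c) lam U →
        U ⊆ Metric.ball (0 : K) (rQuad p lam γ₀ m s t)) ∧
    (LinearizableOn (fun x : K => lam * x + x ^ 2) lam
        (Metric.ball (0 : K) (rQuad p lam γ₀ m s t)) ∧
      ∀ U : Set K, IsZeroDisk U → LinearizableOn (fun x : K => lam * x + x ^ 2) lam U →
        U ⊆ Metric.ball (0 : K) (rQuad p lam γ₀ m s t)) := by
  have hp : p.Prime := Fact.out
  have hpn : ‖(p : K)‖ = (p : ℝ)⁻¹ := by
    simpa using hiso (p : ℚ_[p])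
  have hm1 : m = 1 := le_antisymm (hm.2 ⟨le_rfl, by rwa [pow_one]⟩) hm.1.1
  subst hm1
  rw [pow_one] at hs ht
  simp only [pow_one] at hγmin
  rw [one_div, ← hpn] at hlam1
  have hl1 := norm_eq_one_of_norm_one_sub_lt hlam2
  refine ⟨linearizableOn_ball_rQuad_and_maximal hp hp3 hpn hroot hlam1 hlam2 hs hγ₀ hγmin ht
    hc0 hc1 hc hc2 hc3, ?_⟩
  rw [← pEval_quadCoeff]
  refine linearizableOn_ball_rQuad_and_maximal hp hp3 hpn hroot hlam1 hlam2 hs hγ₀ hγmin ht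
    (by simp [quadCoeff]) (by simp [quadCoeff]) (fun i => ?_) (by simp [quadCoeff])
    (by simp [quadCoeff])
  unfold quadCoeff
  split_ifs <;> simp [hl1]
end
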